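/- arXiv:1304.3873 — 8 statements merged into one kernel-verified Lean document; each statement's English description precedes it below -/
import Mathlib

section
/- For every integer λ > 2 the following holds. Let ν be a Borel probability measure on a compact interval Δ ⊂ ℝ. Then for every interval I ⊂ Δ there exists a measurable subset I'(λ) ⊂ I such that Leb(I'(λ)) > |I|·(1 − 3·∑_{i=1}^∞ λ^{−i}) = |I|·(1 − 3/(λ − 1)), and for every t ∈ I'(λ) and every integer n ≥ 1 one has ν([t − |I|·λ^{−3n}, t + |I|·λ^{−3n}]) < λ^{−n}. -/
open MeasureTheory Set Filter

/-- The mean over `t` of the mass of `[t - r, t + r]` is `2 * r` times the total mass. -/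
theorem lintegral_measure_Icc_sub_add (ν : Measure ℝ) [IsProbabilityMeasure ν] (r : ℝ) :
    Measurable (fun t : ℝ => ν (Set.Icc (t - r) (t + r))) ∧
      ∫⁻ t, ν (Set.Icc (t - r) (t + r)) = ENNReal.ofReal (2 * r) := by
  have hS : MeasurableSet {p : ℝ × ℝ | p.1 - r ≤ p.2 ∧ p.2 ≤ p.1 + r} := by
    rw [Set.ofPred_and]
    exact (measurableSet_le (by fun_prop) (by fun_prop)).inter
      (measurableSet_le (by fun_prop) (by fun_prop))
  refine ⟨measurable_measure_prodMk_left hS, ?_⟩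
  have h₁ := Measure.prod_apply (μ := (volume : Measure ℝ)) (ν := ν) hS
  have h₂ := Measure.prod_apply_symm (μ := (volume : Measure ℝ)) (ν := ν) hS
  refine h₁.symm.trans (h₂.trans ?_)
  have hfib (s : ℝ) : (fun t : ℝ => (t, s)) ⁻¹' {p : ℝ × ℝ | p.1 - r ≤ p.2 ∧ p.2 ≤ p.1 + r} =
      Set.Icc (s - r) (s + r) := by
    ext t
    simp only [Set.mem_preimage, Set.mem_ofPred_eq, Set.mem_Icc]
    constructor <;> rintro ⟨h, h'⟩ <;> constructor <;> linarith
  have hlen (s : ℝ) : s + r - (s - r) = 2 * r := by ring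
  simp only [hfib, Real.volume_Icc, hlen, lintegral_const, measure_univ, mul_one]

/-- The points around which `ν` puts mass at least `ε` at scale `r` form a set of Lebesgue measure
at most `2 * r / ε`. -/
theorem volume_le_measure_Icc_sub_add (ν : Measure ℝ) [IsProbabilityMeasure ν] (r : ℝ) {ε : ℝ}
    (hε : 0 < ε) :
    volume {t : ℝ | ENNReal.ofReal ε ≤ ν (Set.Icc (t - r) (t + r))} ≤
      ENNReal.ofReal (2 * r / ε) := by
  obtain ⟨hm, hi⟩ := lintegral_measure_Icc_sub_add ν r
  rw [ENNReal.ofReal_div_of_pos hε, ← hi]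
  exact meas_ge_le_lintegral_div hm.aemeasurable (by simpa using hε) ENNReal.ofReal_ne_top

/-- **Exponential growth lemma** (Lemma 2 of the paper, scaled version).
For every integer `λ > 2`, every Borel probability measure `ν` on a compact interval
`Δ = [a,b]`, and every (nondegenerate closed) interval `I = [c,d] ⊆ Δ`, there is a
measurable subset `I' ⊆ I` with `Leb(I') > |I|·(1 - 3/(λ-1))` such that for every
`t ∈ I'` and every `n ≥ 1`, `ν([t - |I|·λ^{-3n}, t + |I|·λ^{-3n}]) < λ^{-n}`. -/
theorem stmt0 (l : ℤ) (hl : 2 < l)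
    (ν : Measure ℝ) [IsProbabilityMeasure ν]
    (a b : ℝ) (hab : a ≤ b) (hν : ν (Set.Icc a b)ᶜ = 0)
    (c d : ℝ) (hac : a ≤ c) (hcd : c < d) (hdb : d ≤ b) :
    ∃ I' : Set ℝ, MeasurableSet I' ∧ I' ⊆ Set.Icc c d ∧
      ENNReal.ofReal ((d - c) * (1 - 3 / ((l : ℝ) - 1))) < volume I' ∧
      ∀ t ∈ I', ∀ n : ℕ, 1 ≤ n →
        ν (Set.Icc (t - (d - c) * (l : ℝ) ^ (-(3 * n : ℤ)))
            (t + (d - c) * (l : ℝ) ^ (-(3 * n : ℤ)))) <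
          ENNReal.ofReal ((l : ℝ) ^ (-(n : ℤ))) := by
  have hl' : (3 : ℝ) ≤ l := by exact_mod_cast hl
  have hl0 : (l : ℝ) ≠ 0 := by positivity
  have hlen : 0 < d - c := sub_pos.2 hcd
  set q : ℝ := ((l : ℝ) ^ 2)⁻¹ with hq
  have hq0 : 0 < q := by positivity
  have hq1 : q < 1 := inv_lt_one_of_one_lt₀ (by nlinarith)
  let r : ℕ → ℝ := fun n => (d - c) * (l : ℝ) ^ (-(3 * n : ℤ))
  let B : ℕ → Set ℝ := fun n =>
    {t | ENNReal.ofReal ((l : ℝ) ^ (-(n : ℤ))) ≤ ν (Set.Icc (t - r n) (t + r n))}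
  have hBm (n : ℕ) : MeasurableSet (B n) :=
    measurableSet_le measurable_const (lintegral_measure_Icc_sub_add ν (r n)).1
  have hB (n : ℕ) : volume (B (n + 1)) ≤ ENNReal.ofReal (2 * (d - c) * q * q ^ n) := by
    refine (volume_le_measure_Icc_sub_add ν (r (n + 1)) (by positivity)).trans_eq ?_
    congr 1
    have h₁ : (l : ℝ) ^ (-(3 * (n + 1 : ℕ) : ℤ)) = (((l : ℝ) ^ (n + 1)) ^ 3)⁻¹ := by
      rw [zpow_neg, ← pow_mul, mul_comm (n + 1) 3]
      norm_cast
    have h₂ : (l : ℝ) ^ (-((n + 1 : ℕ) : ℤ)) = ((l : ℝ) ^ (n + 1))⁻¹ := by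
      rw [zpow_neg, zpow_natCast]
    have h₃ : q * q ^ n = (((l : ℝ) ^ (n + 1)) ^ 2)⁻¹ := by
      rw [← pow_succ', hq, inv_pow, ← pow_mul, ← pow_mul, mul_comm 2]
    simp only [r]
    rw [h₁, h₂, mul_assoc _ q, h₃]
    field_simp
  have hsum : volume (⋃ n, B (n + 1)) ≤ ENNReal.ofReal (2 * (d - c) * q * (1 - q)⁻¹) := by
    refine (measure_iUnion_le _).trans ((ENNReal.tsum_le_tsum hB).trans_eq ?_)
    rw [← ENNReal.ofReal_tsum_of_nonneg (fun n => by positivity)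
      ((summable_geometric_of_lt_one hq0.le hq1).mul_left _), tsum_mul_left,
      tsum_geometric_of_lt_one hq0.le hq1]
  have hq' : q * (1 - q)⁻¹ = 1 / ((l : ℝ) ^ 2 - 1) := by
    have : (l : ℝ) ^ 2 - 1 ≠ 0 := by nlinarith
    rw [hq]
    field_simp
  refine ⟨Set.Icc c d \ ⋃ n, B (n + 1), measurableSet_Icc.diff (.iUnion fun n => hBm _),
    Set.sdiff_subset, ?_, ?_⟩
  · refine lt_of_lt_of_le ?_ ((tsub_le_tsub_left hsum _).trans le_measure_sdiff)
    have hsq : (8 : ℝ) ≤ (l : ℝ) ^ 2 - 1 := by nlinarith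
    have hl1 : (0 : ℝ) < l - 1 := by linarith
    have hsmall : 1 / ((l : ℝ) ^ 2 - 1) ≤ 1 / 8 := one_div_le_one_div_of_le (by norm_num) hsq
    have hlt : 2 * (1 / ((l : ℝ) ^ 2 - 1)) < 3 / ((l : ℝ) - 1) := by
      rw [mul_one_div, div_lt_div_iff₀ (by linarith) hl1]
      nlinarith
    rw [mul_assoc _ q, hq', Real.volume_Icc, ← ENNReal.ofReal_sub _ (by positivity),
      ENNReal.ofReal_lt_ofReal_iff (by nlinarith)]
    nlinarith
  · rintro t ⟨-, ht⟩ n hn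
    obtain ⟨m, rfl⟩ := Nat.exists_eq_add_of_le' hn
    exact not_le.1 fun h => ht (Set.mem_iUnion.2 ⟨m, h⟩)
end

section
/- Let ν be a finite Borel measure on a compact interval Δ ⊂ ℝ. Then Lebesgue-almost every t ∈ Δ has the following property: there exists an integer λ > 2 such that for all integers n ≥ 1, ν([t − λ^{−3n}, t + λ^{−3n}]) ≤ λ^{−n}. -/
open MeasureTheory Set Filter

/-- At Lebesgue-almost every point, a locally finite measure of the centred interval of radius `r`
is `O(r)` as `r → 0`. -/
theorem ae_exists_measure_closedBall_le (ν : Measure ℝ) [IsLocallyFiniteMeasure ν] :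
    ∀ᵐ t, ∃ C : ℕ, ∃ δ > (0 : ℝ), ∀ r : ℝ, 0 < r → r < δ →
      ν (Metric.closedBall t r) ≤ ENNReal.ofReal (C * (2 * r)) := by
  filter_upwards [Besicovitch.ae_tendsto_rnDeriv ν volume, ν.rnDeriv_lt_top volume] with t ht hfin
  obtain ⟨C, hC⟩ := ENNReal.exists_nat_gt hfin.ne
  obtain ⟨δ, hδ, hsub⟩ := mem_nhdsGT_iff_exists_Ioo_subset.1 (ht.eventually_lt_const hC)
  refine ⟨C, δ, hδ, fun r hr hrδ => ?_⟩
  have hlt : ν (Metric.closedBall t r) / volume (Metric.closedBall t r) < C := hsub ⟨hr, hrδ⟩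
  rw [Real.volume_closedBall] at hlt
  have hpos : ENNReal.ofReal (2 * r) ≠ 0 := by simpa using hr
  rw [ENNReal.ofReal_mul C.cast_nonneg, ENNReal.ofReal_natCast]
  exact (ENNReal.div_le_iff hpos ENNReal.ofReal_ne_top).1 hlt.le

/-- Let `ν` be a finite Borel measure on a compact interval `Δ = [a,b] ⊆ ℝ`.
Then Lebesgue-almost every `t ∈ Δ` admits an integer `λ > 2` such that for all
integers `n ≥ 1`, `ν([t - λ^{-3n}, t + λ^{-3n}]) ≤ λ^{-n}`. -/
theorem stmt1 (ν : Measure ℝ) [IsFiniteMeasure ν] (a b : ℝ) (hab : a ≤ b)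
    (hν : ν (Set.Icc a b)ᶜ = 0) :
    ∀ᵐ t ∂(volume.restrict (Set.Icc a b)),
      ∃ l : ℤ, 2 < l ∧ ∀ n : ℕ, 1 ≤ n →
        ν (Set.Icc (t - (l : ℝ) ^ (-(3 * n : ℤ))) (t + (l : ℝ) ^ (-(3 * n : ℤ)))) ≤
          ENNReal.ofReal ((l : ℝ) ^ (-(n : ℤ))) := by
  refine ae_restrict_of_ae ?_
  filter_upwards [ae_exists_measure_closedBall_le ν] with t ⟨C, δ, hδ, hball⟩
  obtain ⟨N, hN⟩ := exists_nat_gt δ⁻¹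
  have hNpos : (0 : ℝ) ≤ N := N.cast_nonneg
  have hCpos : (0 : ℝ) ≤ C := C.cast_nonneg
  refine ⟨3 + 2 * C + N, by lia, fun n hn => ?_⟩
  push_cast
  set x : ℝ := 3 + 2 * C + N with hx
  have hx1 : 1 ≤ x := by linarith
  have hx0 : 0 < x := by linarith
  have hxinv : x⁻¹ < δ := inv_lt_of_inv_lt₀ hδ (by linarith)
  have hr : x ^ (-(3 * n : ℤ)) < δ := by
    refine lt_of_le_of_lt ?_ hxinv
    rw [← zpow_neg_one]
    exact zpow_le_zpow_right₀ hx1 (by lia)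
  rw [← Real.closedBall_eq_Icc]
  refine (hball _ (zpow_pos hx0 _) hr).trans (ENNReal.ofReal_le_ofReal ?_)
  calc (C : ℝ) * (2 * x ^ (-(3 * n : ℤ))) = 2 * C * x ^ (-(3 * n : ℤ)) := by ring
    _ ≤ x ^ (1 : ℤ) * x ^ (-(3 * n : ℤ)) := by
      gcongr
      rw [zpow_one]
      linarith
    _ = x ^ (1 + -(3 * n : ℤ)) := (zpow_add₀ hx0.ne' _ _).symm
    _ ≤ x ^ (-(n : ℤ)) := zpow_le_zpow_right₀ hx1 (by lia)
end

section
/- Let (X,d) be a metric space, let s > 0, and let μ be a finite Borel measure on X with s-growth. Let z ∈ X and let r ∈ (0,1] be a λ-good radius for μ at z for some integer λ > 2. Then ∫_{ {x : d(x,z) < r} } |log(r − d(x,z))| dμ(x) < ∞. -/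
open MeasureTheory Set Filter Metric

/-- The logarithm of `t ∈ (0, 1]` is controlled by the number of scales `b⁻ⁿ` that exceed `t`. -/
lemma ofReal_abs_log_le_mul_one_add_tsum {b t : ℝ} (hb : 1 < b) (ht0 : 0 < t) (ht1 : t ≤ 1) :
    ENNReal.ofReal |Real.log t| ≤ ENNReal.ofReal (Real.log b) *
      (1 + ∑' n : ℕ, {u : ℝ | u ≤ (b ^ (n + 1))⁻¹}.indicator 1 t) := by
  have hb0 : 0 < b := one_pos.trans hb
  have hL : 0 < Real.log b := Real.log_pos hb
  have hlog : |Real.log t| = -Real.log t := abs_of_nonpos (Real.log_nonpos ht0.le ht1)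
  set m := ⌊-Real.log t / Real.log b⌋₊
  have hquot : 0 ≤ -Real.log t / Real.log b := by
    rw [← hlog]
    positivity
  have hupper : -Real.log t ≤ Real.log b * (1 + m) := by
    have h := (Nat.lt_floor_add_one (-Real.log t / Real.log b)).le
    rw [div_le_iff₀ hL] at h
    linarith
  have hlower : m * Real.log b ≤ -Real.log t := by
    rw [← le_div_iff₀ hL]
    exact Nat.floor_le hquot
  have hmem : ∀ n ∈ Finset.range m, t ≤ (b ^ (n + 1))⁻¹ := by
    intro n hn
    rw [← Real.log_le_log_iff ht0 (by positivity), Real.log_inv, Real.log_pow]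
    have hnm : ((n + 1 : ℕ) : ℝ) ≤ m := by exact_mod_cast Finset.mem_range.mp hn
    nlinarith
  have hsum : (m : ENNReal) ≤ ∑' n : ℕ, {u : ℝ | u ≤ (b ^ (n + 1))⁻¹}.indicator 1 t := by
    refine le_trans (le_of_eq ?_) (ENNReal.sum_le_tsum (Finset.range m))
    rw [Finset.sum_eq_card_nsmul (b := 1), Finset.card_range, nsmul_one]
    intro n hn
    have ht : t ∈ {u : ℝ | u ≤ (b ^ (n + 1))⁻¹} := hmem n hn
    rw [indicator_of_mem ht, Pi.one_apply]
  calc ENNReal.ofReal |Real.log t| ≤ ENNReal.ofReal (Real.log b * (1 + m)) := by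
        rw [hlog]
        exact ENNReal.ofReal_le_ofReal hupper
    _ = ENNReal.ofReal (Real.log b) * (1 + m) := by
        rw [ENNReal.ofReal_mul hL.le, ENNReal.ofReal_add zero_le_one m.cast_nonneg,
          ENNReal.ofReal_one, ENNReal.ofReal_natCast]
    _ ≤ _ := by gcongr

/-- A positive function bounded by `1` whose sublevel sets at the scales `b⁻ⁿ` have summable
measure has integrable logarithm. -/
lemma lintegral_abs_log_lt_top {α : Type*} [MeasurableSpace α] {ν : Measure α} [IsFiniteMeasure ν]
    {f : α → ℝ} (hf : Measurable f) (hf0 : ∀ᵐ x ∂ν, 0 < f x) (hf1 : ∀ᵐ x ∂ν, f x ≤ 1)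
    {b : ℝ} (hb : 1 < b) (hsum : ∑' n : ℕ, ν {x | f x ≤ (b ^ (n + 1))⁻¹} ≠ ⊤) :
    ∫⁻ x, ENNReal.ofReal |Real.log (f x)| ∂ν < ⊤ := by
  have hmeas : ∀ n : ℕ, MeasurableSet {x | f x ≤ (b ^ (n + 1))⁻¹} := fun n =>
    measurableSet_le hf measurable_const
  calc ∫⁻ x, ENNReal.ofReal |Real.log (f x)| ∂ν
      ≤ ∫⁻ x, ENNReal.ofReal (Real.log b) *
          (1 + ∑' n : ℕ, {x | f x ≤ (b ^ (n + 1))⁻¹}.indicator 1 x) ∂ν := by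
        refine lintegral_mono_ae ?_
        filter_upwards [hf0, hf1] with x h0 h1
        exact ofReal_abs_log_le_mul_one_add_tsum hb h0 h1
    _ = ENNReal.ofReal (Real.log b) *
          (ν univ + ∑' n : ℕ, ν {x | f x ≤ (b ^ (n + 1))⁻¹}) := by
        rw [lintegral_const_mul' _ _ ENNReal.ofReal_ne_top, lintegral_add_left measurable_const,
          lintegral_one, lintegral_tsum fun n => (measurable_one.indicator (hmeas n)).aemeasurable]
        simp_rw [lintegral_indicator_one (hmeas _)]
    _ < ⊤ := ENNReal.mul_lt_top ENNReal.ofReal_lt_top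
        (ENNReal.add_lt_top.mpr ⟨measure_lt_top ν univ, hsum.lt_top⟩)

/-- Let `μ` be a finite Borel measure with `s`-growth on a metric space `X`, let `z ∈ X`
and let `r ∈ (0,1]` be a `λ`-good radius for `μ` at `z` for some integer `λ > 2`. Then
`∫_{d(x,z) < r} |log(r - d(x,z))| dμ(x) < ∞`. -/
theorem stmt4 {X : Type*} [MetricSpace X] [MeasurableSpace X] [BorelSpace X]
    (s : ℝ) (hs : 0 < s) (μ : Measure X) [IsFiniteMeasure μ]
    (cμ : ℝ) (hcμ : 0 < cμ)
    (hgrowth : ∀ (x : X) (ρ : ℝ), 0 < ρ →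
      μ (Metric.closedBall x ρ) ≤ ENNReal.ofReal (cμ * ρ ^ s))
    (z : X) (r : ℝ) (hr0 : 0 < r) (hr1 : r ≤ 1)
    (l : ℤ) (hl : 2 < l)
    (hgood : ∀ n : ℕ, 1 ≤ n →
      μ {x : X | r - (l : ℝ) ^ (-(3 * n : ℤ)) ≤ dist z x ∧
          dist z x ≤ r + (l : ℝ) ^ (-(3 * n : ℤ))} ≤
        ENNReal.ofReal ((l : ℝ) ^ (-(n : ℤ)))) :
    ∫⁻ x in Metric.ball z r, ENNReal.ofReal |Real.log (r - dist x z)| ∂μ < ⊤ := by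
  have hl1 : (1 : ℝ) < l := by exact_mod_cast (by lia : (1 : ℤ) < l)
  have hl0 : (0 : ℝ) < l := one_pos.trans hl1
  refine lintegral_abs_log_lt_top (b := (l : ℝ) ^ 3) (by fun_prop) ?_ ?_
    (one_lt_pow₀ hl1 three_ne_zero) ?_
  · filter_upwards [ae_restrict_mem measurableSet_ball] with x hx
    exact sub_pos.mpr (mem_ball.mp hx)
  · filter_upwards with x
    linarith [dist_nonneg (x := x) (y := z)]
  · have hle : ∀ n : ℕ, μ.restrict (ball z r) {x | r - dist x z ≤ (((l : ℝ) ^ 3) ^ (n + 1))⁻¹} ≤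
        ENNReal.ofReal ((l : ℝ)⁻¹ ^ (n + 1)) := by
      intro n
      have hscale : (l : ℝ) ^ (-(3 * (n + 1 : ℕ) : ℤ)) = (((l : ℝ) ^ 3) ^ (n + 1))⁻¹ := by
        rw [zpow_neg, ← pow_mul]
        norm_cast
      have hbound : (l : ℝ) ^ (-((n + 1 : ℕ) : ℤ)) = (l : ℝ)⁻¹ ^ (n + 1) := by
        rw [zpow_neg, zpow_natCast, inv_pow]
      have hn := hgood (n + 1) (Nat.le_add_left 1 n)
      rw [hscale, hbound] at hn
      rw [Measure.restrict_apply' measurableSet_ball]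
      refine (measure_mono ?_).trans hn
      rintro x ⟨hx, hxr⟩
      have hpos : 0 < (((l : ℝ) ^ 3) ^ (n + 1))⁻¹ := by positivity
      simp only [mem_ofPred_eq, mem_ball, dist_comm x z] at hx hxr ⊢
      constructor <;> linarith
    refine ne_top_of_le_ne_top ?_ (ENNReal.tsum_le_tsum hle)
    refine Summable.tsum_ofReal_ne_top ?_
    exact (summable_nat_add_iff 1).mpr
      (summable_geometric_of_lt_one (by positivity) (inv_lt_one_of_one_lt₀ hl1))
end

section
/- Let (X,d) be a metric space, let s > 0, let μ be a finite Borel measure on X with s-growth, and let k be an s-dimensional kernel on X. Let z ∈ X and let r ∈ (0,1] be a λ-good radius for μ at z for some integer λ > 2, and set B = B(z,r) (the closed ball). Then ∫_B ∫_{X \ B} |k(x,y)| dμ(y) dμ(x) < ∞. -/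
open MeasureTheory Set Filter Metric

/-- A negative power of a positive number is dominated by a geometric sum over the scales
above that number. -/
theorem ofReal_rpow_neg_le_tsum_indicator {q d s : ℝ} (hs : 0 < s) (hq0 : 0 < q) (hq1 : q < 1)
    (hd : 0 < d) :
    ENNReal.ofReal (d ^ (-s)) ≤ ENNReal.ofReal (q ^ (-s)) *
      (1 + ∑' j : ℕ, ENNReal.ofReal ((q ^ (j + 1)) ^ (-s)) *
        (Iic (q ^ (j + 1))).indicator 1 d) := by
  have hq : 1 ≤ q ^ (-s) := Real.one_le_rpow_of_pos_of_le_one_of_nonpos hq0 hq1.le (by linarith)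
  rcases le_or_gt d 1 with hd1 | hd1
  · obtain ⟨n, hn1, hn2⟩ := exists_nat_pow_near_of_lt_one hd hd1 hq0 hq1
    have hle : ENNReal.ofReal (d ^ (-s)) ≤
        ENNReal.ofReal (q ^ (-s)) * ENNReal.ofReal ((q ^ n) ^ (-s)) := by
      rw [← ENNReal.ofReal_mul (by positivity), ← Real.mul_rpow hq0.le (by positivity),
        ← pow_succ']
      exact ENNReal.ofReal_le_ofReal
        (Real.rpow_le_rpow_of_nonpos (by positivity) hn1.le (by linarith))
    refine hle.trans ?_
    gcongr
    cases n with
    | zero => simp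
    | succ m =>
      refine le_trans ?_ (le_add_self.trans' (ENNReal.le_tsum m))
      simp [indicator_of_mem (mem_Iic.2 hn2)]
  · calc ENNReal.ofReal (d ^ (-s)) ≤ ENNReal.ofReal (q ^ (-s)) * 1 := by
          rw [mul_one]
          exact ENNReal.ofReal_le_ofReal
            ((Real.rpow_le_one_of_one_le_of_nonpos hd1.le (by linarith)).trans hq)
      _ ≤ _ := by gcongr; exact le_self_add

/-- Let `μ` be a finite Borel measure with `s`-growth on a metric space `X` and let `k`
be an `s`-dimensional kernel. If `r ∈ (0,1]` is a `λ`-good radius for `μ` at `z` for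
some integer `λ > 2` and `B = B(z,r)` is the closed ball, then
`∫_B ∫_{X \ B} |k(x,y)| dμ(y) dμ(x) < ∞`. -/
theorem stmt6 {X : Type*} [MetricSpace X] [MeasurableSpace X] [BorelSpace X]
    (s : ℝ) (hs : 0 < s) (μ : Measure X) [IsFiniteMeasure μ]
    (cμ : ℝ) (hcμ : 0 < cμ)
    (hgrowth : ∀ (x : X) (ρ : ℝ), 0 < ρ →
      μ (Metric.closedBall x ρ) ≤ ENNReal.ofReal (cμ * ρ ^ s))
    (k : X → X → ℝ) (hkmeas : Measurable (Function.uncurry k))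
    (c : ℝ) (hc : 0 < c)
    (hk : ∀ x y : X, x ≠ y → |k x y| ≤ c * (dist x y) ^ (-s))
    (z : X) (r : ℝ) (hr0 : 0 < r) (hr1 : r ≤ 1)
    (l : ℤ) (hl : 2 < l)
    (hgood : ∀ n : ℕ, 1 ≤ n →
      μ {x : X | r - (l : ℝ) ^ (-(3 * n : ℤ)) ≤ dist z x ∧
          dist z x ≤ r + (l : ℝ) ^ (-(3 * n : ℤ))} ≤
        ENNReal.ofReal ((l : ℝ) ^ (-(n : ℤ)))) :
    ∫⁻ x in Metric.closedBall z r,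
        ∫⁻ y in (Metric.closedBall z r)ᶜ, ENNReal.ofReal |k x y| ∂μ ∂μ < ⊤ := by
  have hl' : (2 : ℝ) < l := by exact_mod_cast hl
  set q : ℝ := ((l : ℝ) ^ 3)⁻¹ with hq
  have hq0 : 0 < q := by positivity
  have hq1 : q < 1 := inv_lt_one_of_one_lt₀ (one_lt_pow₀ (by linarith) (by norm_num))
  have hqpow (n : ℕ) : (l : ℝ) ^ (-(3 * n : ℤ)) = q ^ n := by
    rw [zpow_neg, hq, inv_pow, ← pow_mul]
    norm_cast
  set B := closedBall z r with hB
  set K : ENNReal := ENNReal.ofReal c * ENNReal.ofReal (q ^ (-s)) with hK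
  have hKtop : K ≠ ⊤ := by finiteness
  let E : ℕ → Set X := fun j ↦ {x | r - q ^ (j + 1) ≤ dist z x}
  have hE (j : ℕ) : MeasurableSet (E j) :=
    (isClosed_le continuous_const (continuous_const.dist continuous_id)).measurableSet
  have hμE (j : ℕ) : μ.restrict B (E j) ≤ ENNReal.ofReal ((l : ℝ)⁻¹ ^ (j + 1)) := by
    rw [Measure.restrict_apply (hE j)]
    refine (measure_mono ?_).trans ((hgood (j + 1) (by omega)).trans_eq ?_)
    · rintro x ⟨hx, hxB⟩
      have : dist z x ≤ r := by rwa [dist_comm]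
      rw [mem_ofPred_eq, hqpow]
      exact ⟨hx, by have := pow_pos hq0 (j + 1); linarith⟩
    · rw [zpow_neg, zpow_natCast, inv_pow]
  have hpoint : ∀ x ∈ B, ∀ y ∈ Bᶜ, ENNReal.ofReal |k x y| ≤
      K * (1 + ∑' j : ℕ, ENNReal.ofReal ((q ^ (j + 1)) ^ (-s)) * (E j).indicator 1 x *
        (closedBall x (q ^ (j + 1))).indicator 1 y) := by
    intro x hx y hy
    have hxy : x ≠ y := fun h ↦ hy (h ▸ hx)
    calc ENNReal.ofReal |k x y| ≤ ENNReal.ofReal c * ENNReal.ofReal (dist x y ^ (-s)) := by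
          rw [← ENNReal.ofReal_mul hc.le]
          exact ENNReal.ofReal_le_ofReal (hk x y hxy)
      _ ≤ _ := by
          rw [hK, mul_assoc]
          gcongr
          refine (ofReal_rpow_neg_le_tsum_indicator hs hq0 hq1 (dist_pos.2 hxy)).trans ?_
          refine mul_le_mul' le_rfl (add_le_add le_rfl (ENNReal.tsum_le_tsum fun j ↦ ?_))
          rw [mul_assoc]
          gcongr
          by_cases h : dist x y ≤ q ^ (j + 1)
          · have hxE : x ∈ E j := by
              have h1 : r < dist y z := by simpa [hB] using hy
              have h2 := dist_triangle_left y z x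
              rw [dist_comm x z] at h2
              change r - q ^ (j + 1) ≤ dist z x
              linarith
            have hyB : y ∈ closedBall x (q ^ (j + 1)) := by rwa [mem_closedBall']
            rw [indicator_of_mem hxE, indicator_of_mem hyB, indicator_of_mem (mem_Iic.2 h)]
            simp
          · simp [h]
  have hinner : ∀ x ∈ B, ∫⁻ y in Bᶜ, ENNReal.ofReal |k x y| ∂μ ≤
      K * (μ univ + ∑' j : ℕ, ENNReal.ofReal cμ * (E j).indicator 1 x) := by
    intro x hx
    refine (setLIntegral_mono' isClosed_closedBall.measurableSet.compl (hpoint x hx)).trans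
      ((setLIntegral_le_lintegral _ _).trans ?_)
    have hm (j : ℕ) : Measurable
        ((closedBall x (q ^ (j + 1))).indicator (1 : X → ENNReal)) :=
      measurable_one.indicator isClosed_closedBall.measurableSet
    rw [lintegral_const_mul' _ _ hKtop, lintegral_add_left measurable_const,
      lintegral_tsum fun j ↦ ((hm j).const_mul _).aemeasurable, lintegral_const, one_mul]
    gcongr with j
    rw [lintegral_const_mul _ (hm j), lintegral_indicator_one isClosed_closedBall.measurableSet]
    have hqj : 0 < q ^ (j + 1) := by positivity
    calc _ ≤ ENNReal.ofReal ((q ^ (j + 1)) ^ (-s)) * (E j).indicator 1 x *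
          ENNReal.ofReal (cμ * (q ^ (j + 1)) ^ s) := by gcongr; exact hgrowth x _ hqj
      _ = ENNReal.ofReal cμ * (E j).indicator 1 x := by
          rw [mul_right_comm, ← ENNReal.ofReal_mul (by positivity), mul_left_comm,
            ← Real.rpow_add hqj, neg_add_cancel, Real.rpow_zero, mul_one]
  refine (setLIntegral_mono' isClosed_closedBall.measurableSet hinner).trans_lt ?_
  have hm (j : ℕ) : Measurable ((E j).indicator (1 : X → ENNReal)) :=
    measurable_one.indicator (hE j)
  rw [lintegral_const_mul' _ _ hKtop, lintegral_add_left measurable_const,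
    lintegral_tsum fun j ↦ ((hm j).const_mul _).aemeasurable, lintegral_const]
  have hgeom : Summable fun j : ℕ ↦ (l : ℝ)⁻¹ ^ (j + 1) :=
    (summable_nat_add_iff 1).2 (summable_geometric_of_lt_one (by positivity)
      (inv_lt_one_of_one_lt₀ (by linarith)))
  refine ENNReal.mul_lt_top hKtop.lt_top (ENNReal.add_lt_top.2 ⟨by finiteness, ?_⟩)
  simp_rw [lintegral_const_mul _ (hm _), lintegral_indicator_one (hE _), ENNReal.tsum_mul_left]
  exact ENNReal.mul_lt_top ENNReal.ofReal_lt_top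
    ((ENNReal.tsum_le_tsum hμE).trans_lt hgeom.tsum_ofReal_lt_top)
end

section
/- Let (X,d) be a metric space, let s > 0, let μ be a finite Borel measure on X with s-growth, and let k be an s-dimensional kernel on X. Let z ∈ X and let r ∈ (0,1] be a λ-good radius for μ at z for some integer λ > 2, and set B = B(z,r). Then lim_{ε → 0⁺} ∫_B ∫_{ {y ∈ X \ B : d(x,y) < ε} } |k(x,y)| dμ(y) dμ(x) = 0. -/
open MeasureTheory Set Filter Metric Topology ENNReal

/-- A truncated kernel integral across the boundary of a ball is controlled by counting the
annuli of geometrically decreasing width around the boundary that contain the base point. -/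
theorem lintegral_kernel_across_closedBall_le {X : Type*} [MetricSpace X] [MeasurableSpace X]
    [BorelSpace X] {s : ℝ} (hs : 0 < s) {μ : Measure X} {cμ : ℝ}
    (hgrowth : ∀ (x : X) (ρ : ℝ), 0 < ρ →
      μ (closedBall x ρ) ≤ ENNReal.ofReal (cμ * ρ ^ s))
    {k : X → X → ℝ} {c : ℝ} (hc : 0 < c)
    (hk : ∀ x y : X, x ≠ y → |k x y| ≤ c * (dist x y) ^ (-s))
    {z x : X} {r q ε : ℝ} (hq0 : 0 < q) (hq1 : q < 1) {N : ℕ} (hε : ε ≤ q ^ N)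
    (hx : x ∈ closedBall z r) :
    ∫⁻ y in (closedBall z r)ᶜ ∩ {y : X | dist x y < ε}, ENNReal.ofReal |k x y| ∂μ ≤
      ∑' n : ℕ, {x : X | r - q ^ (n + N) ≤ dist z x ∧ dist z x ≤ r + q ^ (n + N)}.indicator
        (fun _ => ENNReal.ofReal (c * cμ * q ^ (-s))) x := by
  set A : ℕ → Set X := fun n => {x : X | r - q ^ n ≤ dist z x ∧ dist z x ≤ r + q ^ n}
  have hmeas : MeasurableSet ((closedBall z r)ᶜ ∩ {y : X | dist x y < ε}) :=
    isClosed_closedBall.measurableSet.compl.inter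
      (isOpen_lt (by fun_prop) continuous_const).measurableSet
  have hxr : dist z x ≤ r := by rwa [dist_comm]
  have hpoint : ∀ y ∈ (closedBall z r)ᶜ ∩ {y : X | dist x y < ε}, ENNReal.ofReal |k x y| ≤
      ∑' n : ℕ, (closedBall x (q ^ (n + N))).indicator
        (fun _ => (A (n + N)).indicator
          (fun _ => ENNReal.ofReal (c * (q ^ (n + N + 1)) ^ (-s))) x) y := by
    rintro y ⟨hyB, hyε⟩
    have hyr : r < dist z y := by simpa [dist_comm] using hyB
    have hyε : dist x y < q ^ N := lt_of_lt_of_le hyε hε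
    have htri := dist_triangle z x y
    have hxy : 0 < dist x y := by linarith
    obtain ⟨m, hm1, hm2⟩ := exists_nat_pow_near_of_lt_one hxy
      (hyε.le.trans (pow_le_one₀ hq0.le hq1.le)) hq0 hq1
    have hNm : N ≤ m := by
      have : N < m + 1 := (pow_lt_pow_iff_right_of_lt_one₀ hq0 hq1).1 (hm1.trans hyε)
      omega
    obtain ⟨n, rfl⟩ := Nat.exists_eq_add_of_le' hNm
    refine le_trans ?_ (ENNReal.le_tsum n)
    have hyball : y ∈ closedBall x (q ^ (n + N)) := by rwa [mem_closedBall, dist_comm]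
    have hxA : x ∈ A (n + N) :=
      ⟨by linarith, by linarith [pow_pos hq0 (n + N)]⟩
    rw [indicator_of_mem hyball, indicator_of_mem hxA]
    refine ENNReal.ofReal_le_ofReal ((hk x y (dist_pos.1 hxy)).trans ?_)
    exact mul_le_mul_of_nonneg_left
      (Real.rpow_le_rpow_of_nonpos (pow_pos hq0 _) hm1.le (by linarith)) hc.le
  refine (setLIntegral_mono' hmeas hpoint).trans ((setLIntegral_le_lintegral _ _).trans ?_)
  rw [lintegral_tsum fun n =>
    (measurable_const.indicator isClosed_closedBall.measurableSet).aemeasurable]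
  refine ENNReal.tsum_le_tsum fun n => ?_
  rw [lintegral_indicator_const isClosed_closedBall.measurableSet]
  by_cases hxA : x ∈ A (n + N)
  · rw [indicator_of_mem hxA, indicator_of_mem hxA]
    have hp : 0 < q ^ (n + N) := pow_pos hq0 _
    have hpos : 0 ≤ c * (q ^ (n + N + 1)) ^ (-s) :=
      mul_nonneg hc.le (Real.rpow_nonneg (pow_pos hq0 _).le _)
    refine (mul_le_mul_right (hgrowth x _ hp) _).trans ?_
    rw [← ENNReal.ofReal_mul hpos]
    refine (congrArg ENNReal.ofReal ?_).le
    rw [pow_succ, Real.mul_rpow hp.le hq0.le, Real.rpow_neg hp.le]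
    have : (q ^ (n + N)) ^ s ≠ 0 := (Real.rpow_pos_of_pos hp s).ne'
    field_simp
  · rw [indicator_of_notMem hxA, indicator_of_notMem hxA, zero_mul]

/-- Let `μ` be a finite Borel measure with `s`-growth on a metric space `X` and let `k`
be an `s`-dimensional kernel. If `r ∈ (0,1]` is a `λ`-good radius for `μ` at `z` for
some integer `λ > 2` and `B = B(z,r)` is the closed ball, then
`lim_{ε → 0⁺} ∫_B ∫_{{y ∈ X \ B : d(x,y) < ε}} |k(x,y)| dμ(y) dμ(x) = 0`. -/
theorem stmt7 {X : Type*} [MetricSpace X] [MeasurableSpace X] [BorelSpace X]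
    (s : ℝ) (hs : 0 < s) (μ : Measure X) [IsFiniteMeasure μ]
    (cμ : ℝ) (hcμ : 0 < cμ)
    (hgrowth : ∀ (x : X) (ρ : ℝ), 0 < ρ →
      μ (Metric.closedBall x ρ) ≤ ENNReal.ofReal (cμ * ρ ^ s))
    (k : X → X → ℝ) (hkmeas : Measurable (Function.uncurry k))
    (c : ℝ) (hc : 0 < c)
    (hk : ∀ x y : X, x ≠ y → |k x y| ≤ c * (dist x y) ^ (-s))
    (z : X) (r : ℝ) (hr0 : 0 < r) (hr1 : r ≤ 1)
    (l : ℤ) (hl : 2 < l)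
    (hgood : ∀ n : ℕ, 1 ≤ n →
      μ {x : X | r - (l : ℝ) ^ (-(3 * n : ℤ)) ≤ dist z x ∧
          dist z x ≤ r + (l : ℝ) ^ (-(3 * n : ℤ))} ≤
        ENNReal.ofReal ((l : ℝ) ^ (-(n : ℤ)))) :
    Filter.Tendsto
      (fun ε : ℝ =>
        ∫⁻ x in Metric.closedBall z r,
          ∫⁻ y in (Metric.closedBall z r)ᶜ ∩ {y : X | dist x y < ε},
            ENNReal.ofReal |k x y| ∂μ ∂μ)
      (𝓝[>] (0 : ℝ)) (𝓝 (0 : ℝ≥0∞)) := by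
  have hl1 : (2 : ℝ) < l := by exact_mod_cast hl
  have hl0 : (0 : ℝ) < l := by linarith
  set q : ℝ := (l : ℝ) ^ (-3 : ℤ) with hq
  have hq0 : 0 < q := zpow_pos hl0 _
  have hq1 : q < 1 := zpow_lt_one_of_neg₀ (by linarith) (by norm_num)
  have hqn (n : ℕ) : (l : ℝ) ^ (-(3 * n : ℤ)) = q ^ n := by
    rw [hq, ← zpow_natCast, ← zpow_mul]
    congr 1
  simp only [hqn] at hgood
  set A : ℕ → Set X := fun n => {x : X | r - q ^ n ≤ dist z x ∧ dist z x ≤ r + q ^ n}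
  have hAmeas (n : ℕ) : MeasurableSet (A n) :=
    (isClosed_Icc.preimage (continuous_const.dist continuous_id)).measurableSet
  have hli0 : (0 : ℝ) ≤ (l : ℝ)⁻¹ := by positivity
  have hsum : ∑' n, μ (A n) ≠ ∞ := by
    rw [tsum_eq_zero_add' ENNReal.summable]
    refine ENNReal.add_ne_top.2 ⟨measure_ne_top _ _, ne_top_of_le_ne_top ?_
      (ENNReal.tsum_le_tsum fun n => hgood (n + 1) (by omega))⟩
    have hsummable : Summable fun n : ℕ => (l : ℝ) ^ (-((n + 1 : ℕ) : ℤ)) := by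
      simp_rw [zpow_neg, zpow_natCast, ← inv_pow]
      exact (summable_nat_add_iff 1).2
        (summable_geometric_of_lt_one hli0 (inv_lt_one_of_one_lt₀ (by linarith)))
    exact hsummable.tsum_ofReal_ne_top
  set C : ℝ≥0∞ := ENNReal.ofReal (c * cμ * q ^ (-s))
  have hbound (N : ℕ) (ε : ℝ) (hε : ε ≤ q ^ N) :
      ∫⁻ x in closedBall z r, ∫⁻ y in (closedBall z r)ᶜ ∩ {y : X | dist x y < ε},
        ENNReal.ofReal |k x y| ∂μ ∂μ ≤ C * ∑' n, μ (A (n + N)) := by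
    refine (setLIntegral_mono' isClosed_closedBall.measurableSet fun x hx =>
      lintegral_kernel_across_closedBall_le hs hgrowth hc hk hq0 hq1 hε hx).trans
      ((setLIntegral_le_lintegral _ _).trans ?_)
    rw [lintegral_tsum fun n => (measurable_const.indicator (hAmeas (n + N))).aemeasurable,
      ← ENNReal.tsum_mul_left]
    exact ENNReal.tsum_le_tsum fun n => (lintegral_indicator_const (hAmeas (n + N)) C).le
  have htail : Tendsto (fun N => C * ∑' n, μ (A (n + N))) atTop (𝓝 0) := by
    simpa using ENNReal.Tendsto.const_mul (ENNReal.tendsto_sum_nat_add _ hsum)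
      (Or.inr ENNReal.ofReal_ne_top)
  refine ENNReal.tendsto_nhds_zero.2 fun δ hδ => ?_
  obtain ⟨N, hN⟩ := (ENNReal.tendsto_nhds_zero.1 htail δ hδ).exists
  filter_upwards [Ioc_mem_nhdsGT (pow_pos hq0 N)] with ε hε
  exact (hbound N ε hε.2).trans hN
end

section
/- Let (X,d) be a metric space, let s > 0, let μ be a finite Borel measure on X with s-growth, and let k be an antisymmetric s-dimensional kernel on X. Let z, w ∈ X and let r, ρ ∈ (0,1] be λ-good and λ'-good radii for μ at z and at w respectively (for some integers λ, λ' > 2). Then the limit lim_{ε → 0⁺} ∫_{B(w,ρ)} T^k_{μ,ε}(χ_{B(z,r)})(x) dμ(x) exists, where T^k_{μ,ε}(f)(x) = ∫_{ {y : d(x,y) > ε} } k(x,y) f(y) dμ(y) and B(z,r), B(w,ρ) are closed balls. -/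
open MeasureTheory Set Filter Metric Topology

theorem abs_kernel_le_of_le_dist {X : Type*} [MetricSpace X] {s c : ℝ} {k : X → X → ℝ}
    (hs : 0 < s) (hc : 0 < c)
    (hk : ∀ x y : X, x ≠ y → |k x y| ≤ c * (dist x y) ^ (-s)) {ε : ℝ} (hε : 0 < ε) {x y : X}
    (h : ε ≤ dist x y) : |k x y| ≤ c * ε ^ (-s) :=
  (hk x y (dist_pos.1 (hε.trans_le h))).trans <| mul_le_mul_of_nonneg_left
    (Real.rpow_le_rpow_of_nonpos hε h (by linarith)) hc.le

section TruncatedKernels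

variable {X : Type*} [MetricSpace X] [MeasurableSpace X] [BorelSpace X]

theorem measurable_measure_inter_dist_gt (μ : Measure X) (ε : ℝ) (B : Set X) :
    Measurable fun x => μ (B ∩ {y | ε < dist x y}) := by
  refine LowerSemicontinuous.measurable fun x c hc => ?_
  have hmono : Monotone fun n : ℕ => B ∩ {y | ε + 1 / ((n : ℝ) + 1) < dist x y} := by
    intro m n hmn y hy
    have := Nat.one_div_le_one_div (α := ℝ) hmn
    exact ⟨hy.1, lt_of_le_of_lt (by linarith) (show ε + 1 / ((m : ℝ) + 1) < dist x y from hy.2)⟩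
  have hunion : ⋃ n : ℕ, B ∩ {y | ε + 1 / ((n : ℝ) + 1) < dist x y} =
      B ∩ {y | ε < dist x y} := by
    ext y
    simp only [mem_iUnion, mem_inter_iff, mem_ofPred_eq]
    constructor
    · rintro ⟨n, hB, hn⟩
      have := Nat.one_div_pos_of_nat (α := ℝ) (n := n)
      exact ⟨hB, by linarith⟩
    · rintro ⟨hB, h⟩
      obtain ⟨n, hn⟩ := exists_nat_one_div_lt (sub_pos.2 h)
      exact ⟨n, hB, by linarith⟩
  have htend := tendsto_measure_iUnion_atTop (μ := μ) hmono
  rw [hunion] at htend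
  obtain ⟨n, hn⟩ := (htend.eventually (lt_mem_nhds hc)).exists
  filter_upwards [ball_mem_nhds x (Nat.one_div_pos_of_nat (α := ℝ) (n := n))] with x' hx'
  refine hn.trans_le (measure_mono fun y hy => ⟨hy.1, ?_⟩)
  have h1 : ε + 1 / ((n : ℝ) + 1) < dist x y := hy.2
  have h2 := dist_triangle_left x y x'
  rw [mem_ball] at hx'
  change ε < dist x' y
  linarith

theorem measurableSet_dist_gt (x : X) (ε : ℝ) : MeasurableSet {y : X | ε < dist x y} :=
  (isOpen_lt continuous_const (continuous_const.dist continuous_id)).measurableSet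

/-- The kernel sending `x` to the restriction of `μ` to the complement of the closed ball of
radius `ε` around `x`. -/
noncomputable def farKernel (μ : Measure X) (ε : ℝ) : ProbabilityTheory.Kernel X X where
  toFun x := μ.restrict {y | ε < dist x y}
  measurable' := Measure.measurable_of_measurable_coe _ fun B hB => by
    simp_rw [Measure.restrict_apply hB]
    exact measurable_measure_inter_dist_gt μ ε B

instance (μ : Measure X) [IsFiniteMeasure μ] (ε : ℝ) :
    ProbabilityTheory.IsFiniteKernel (farKernel μ ε) :=
  ⟨μ univ, measure_lt_top _ _, fun _ => Measure.restrict_apply_le _ _⟩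

/-- The truncated singular integral of the indicator function of `Y`. -/
noncomputable def truncSing (μ : Measure X) (k : X → X → ℝ) (ε : ℝ) (Y : Set X) (x : X) : ℝ :=
  ∫ y in {y : X | ε < dist x y}, k x y * indicator Y (fun _ => (1 : ℝ)) y ∂μ

theorem stronglyMeasurable_truncSing (μ : Measure X) [IsFiniteMeasure μ] {k : X → X → ℝ}
    (hk : Measurable (Function.uncurry k)) (ε : ℝ) {Y : Set X} (hY : MeasurableSet Y) :
    StronglyMeasurable (truncSing μ k ε Y) := by
  have h : StronglyMeasurable fun p : X × X => k p.1 p.2 * indicator Y (fun _ => (1 : ℝ)) p.2 :=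
    (hk.mul ((measurable_const.indicator hY).comp measurable_snd)).stronglyMeasurable
  exact h.integral_kernel_prod_right' (κ := farKernel μ ε)

theorem exists_countable_net (μ : Measure X) [IsFiniteMeasure μ] {ε : ℝ} (hε : 0 < ε) :
    ∃ D : Set X, D.Countable ∧ ∀ x, 0 < μ (ball x ε) → ∃ q ∈ D, dist x q < 4 * ε := by
  obtain ⟨u, hu, hdisj, hcov⟩ := Vitali.exists_disjoint_subfamily_covering_enlargement_ball
    {x : X | 0 < μ (ball x ε)} id (fun _ => ε) ε (fun _ _ => le_rfl) 4 (by norm_num)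
  refine ⟨u, ?_, fun x hx => ?_⟩
  · have h := Measure.countable_meas_pos_of_disjoint_iUnion (μ := μ)
      (As := fun i : u => ball (i : X) ε) (fun _ => measurableSet_ball)
      (fun i j hij => hdisj i.2 j.2 (fun h => hij (Subtype.ext h)))
    have h' : {i : u | 0 < μ (ball (i : X) ε)} = univ := eq_univ_of_forall fun i => hu i.2
    rw [h'] at h
    exact countable_coe_iff.1 (countable_univ_iff.1 h)
  · obtain ⟨b, hb, hsub⟩ := hcov x hx
    exact ⟨b, hb, hsub (mem_ball_self hε)⟩

/-- Without separability, `{p | ε < dist p.1 p.2}` need not belong to the product σ-algebra. It is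
approximated by a symmetric set `E` which does, and which has the same slices at all points of the
support of `μ`. -/
theorem exists_symmetric_truncation (μ : Measure X) [IsFiniteMeasure μ] {ε : ℝ} (hε : 0 < ε) :
    ∃ E : Set (X × X), MeasurableSet E ∧ (∀ x y, (x, y) ∈ E ↔ (y, x) ∈ E) ∧
      (∀ x y, 20 * ε < dist x y → (x, y) ∈ E) ∧
      ∀ x, (∀ t > 0, 0 < μ (ball x t)) → ∀ y, (x, y) ∈ E ↔ ε < dist x y := by
  choose! D hDc hD using fun (t : ℝ) (ht : 0 < t) => exists_countable_net μ ht
  set Q : Set X := D (2 * ε) ∪ ⋃ n : ℕ, D (1 / ((n : ℝ) + 1)) with hQ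
  have hQc : Q.Countable :=
    (hDc _ (by linarith)).union (countable_iUnion fun n => hDc _ Nat.one_div_pos_of_nat)
  set O : Set (X × X) := ⋃ q ∈ Q, ⋃ t : ℚ, ball q (t : ℝ) ×ˢ {y | ε + t < dist q y} with hO
  have hOm : MeasurableSet O := .biUnion hQc fun q _ => .iUnion fun t =>
    measurableSet_ball.prod (measurableSet_dist_gt q _)
  have hOsub : ∀ x y, (x, y) ∈ O → ε < dist x y := by
    intro x y h
    simp only [hO, mem_iUnion, mem_prod, mem_ball, mem_ofPred_eq] at h
    obtain ⟨q, -, t, h1, h2⟩ := h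
    have := dist_triangle_left q y x
    linarith
  have hOmem : ∀ x y q, q ∈ Q → 2 * dist x q + ε < dist x y → (x, y) ∈ O := by
    intro x y q hq h
    have h3 := dist_triangle x q y
    obtain ⟨t, ht1, ht2⟩ := exists_rat_btwn (show dist x q < dist q y - ε by linarith)
    simp only [hO, mem_iUnion, mem_prod, mem_ball, mem_ofPred_eq]
    exact ⟨q, hq, t, ht1, by linarith⟩
  set N : Set X := {x | μ (closedBall x ε) = 0} with hN
  have hNm : MeasurableSet N := by
    have hN' : N = {x | μ (univ ∩ {y | ε < dist x y}) = μ univ} := by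
      ext x
      have hcompl : {y | ε < dist x y} = (closedBall x ε)ᶜ := by
        ext y
        simp [dist_comm]
      rw [hN, mem_ofPred_eq, mem_ofPred_eq, univ_inter, hcompl,
        measure_compl measurableSet_closedBall (measure_ne_top _ _)]
      constructor
      · intro h
        simp [h]
      · intro h
        have hadd := measure_add_measure_compl (μ := μ) (measurableSet_closedBall (x := x) (ε := ε))
        rw [measure_compl measurableSet_closedBall (measure_ne_top _ _), h] at hadd
        exact (ENNReal.add_left_inj (measure_ne_top μ univ)).1 (hadd.trans (zero_add _).symm)
    rw [hN']
    exact measurable_measure_inter_dist_gt μ ε univ (measurableSet_singleton _)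
  refine ⟨O ∪ Prod.swap ⁻¹' O ∪ N ×ˢ N, ?_, ?_, ?_, ?_⟩
  · exact (hOm.union (measurable_swap hOm)).union (hNm.prod hNm)
  · intro x y
    simp only [mem_union, mem_preimage, Prod.swap_prod_mk, mem_prod]
    tauto
  · intro x y hxy
    have hfar : ∀ x y, x ∉ N → 20 * ε < dist x y → (x, y) ∈ O := by
      intro x y hx hxy
      obtain ⟨q, hq, hd⟩ := hD (2 * ε) (by linarith) x
        ((pos_iff_ne_zero.2 hx).trans_le (measure_mono (closedBall_subset_ball (by linarith))))
      exact hOmem x y q (Or.inl hq) (by linarith)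
    by_cases hx : x ∈ N
    · by_cases hy : y ∈ N
      · exact Or.inr ⟨hx, hy⟩
      · exact Or.inl (Or.inr (hfar y x hy (by rwa [dist_comm])))
    · exact Or.inl (Or.inl (hfar x y hx hxy))
  · intro x hx y
    constructor
    · rintro ((h | h) | h)
      · exact hOsub x y h
      · rw [dist_comm]
        exact hOsub y x h
      · exact absurd (measure_mono_null ball_subset_closedBall h.1) (hx ε hε).ne'
    · intro h
      obtain ⟨n, hn⟩ := exists_nat_one_div_lt (show 0 < (dist x y - ε) / 8 by linarith)
      obtain ⟨q, hq, hd⟩ := hD (1 / ((n : ℝ) + 1)) Nat.one_div_pos_of_nat x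
        (hx _ Nat.one_div_pos_of_nat)
      exact Or.inl (Or.inl (hOmem x y q (Or.inr (mem_iUnion.2 ⟨n, hq⟩)) (by linarith)))

theorem integral_integral_eq_zero_of_antisymm {α : Type*} [MeasurableSpace α] (ν : Measure α)
    [IsFiniteMeasure ν] {f : α → α → ℝ} (hf : Measurable (Function.uncurry f))
    {M : ℝ} (hM : ∀ x y, |f x y| ≤ M) (hanti : ∀ x y, f x y = -f y x) :
    ∫ x, ∫ y, f x y ∂ν ∂ν = 0 := by
  have hint : Integrable (Function.uncurry f) (ν.prod ν) :=
    Integrable.of_bound hf.aestronglyMeasurable M (.of_forall fun p => hM p.1 p.2)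
  have h1 := integral_integral_swap hint
  have h2 : ∫ y, ∫ x, f x y ∂ν ∂ν = -∫ x, ∫ y, f x y ∂ν ∂ν := by
    rw [← integral_neg]
    congr 1
    ext y
    rw [← integral_neg]
    congr 1
    ext x
    exact hanti x y
  linarith

section Bounds

variable {s c : ℝ} {k : X → X → ℝ}

theorem integrableOn_truncSing (μ : Measure X) [IsFiniteMeasure μ] (hs : 0 < s) (hc : 0 < c)
    (hkm : Measurable (Function.uncurry k))
    (hk : ∀ x y : X, x ≠ y → |k x y| ≤ c * (dist x y) ^ (-s)) {ε : ℝ} (hε : 0 < ε)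
    {Y : Set X} (hY : MeasurableSet Y) (x : X) :
    IntegrableOn (fun y => k x y * indicator Y (fun _ => (1 : ℝ)) y) {y | ε < dist x y} μ := by
  refine Integrable.of_bound (C := c * ε ^ (-s)) ?_ ?_
  · exact ((hkm.comp measurable_prodMk_left).mul
      (measurable_const.indicator hY)).aestronglyMeasurable
  · refine (ae_restrict_mem (measurableSet_dist_gt x ε)).mono fun y hy => ?_
    have h0 : 0 ≤ c * ε ^ (-s) := by positivity
    by_cases hyY : y ∈ Y
    · simpa [hyY] using abs_kernel_le_of_le_dist hs hc hk hε (le_of_lt hy)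
    · simpa [hyY] using h0

theorem integrable_truncSing (μ : Measure X) [IsFiniteMeasure μ] (hs : 0 < s) (hc : 0 < c)
    (hkm : Measurable (Function.uncurry k))
    (hk : ∀ x y : X, x ≠ y → |k x y| ≤ c * (dist x y) ^ (-s)) {ε : ℝ} (hε : 0 < ε)
    {Y : Set X} (hY : MeasurableSet Y) : Integrable (truncSing μ k ε Y) μ := by
  have h0 : 0 ≤ c * ε ^ (-s) := by positivity
  refine Integrable.of_bound (stronglyMeasurable_truncSing μ hkm ε hY).aestronglyMeasurable
    (c * ε ^ (-s) * μ.real univ) (.of_forall fun x => ?_)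
  refine (norm_setIntegral_le_of_norm_le_const (C := c * ε ^ (-s)) (measure_lt_top _ _)
    fun y hy => ?_).trans (mul_le_mul_of_nonneg_left (measureReal_mono (subset_univ _)) h0)
  by_cases hyY : y ∈ Y
  · simpa [hyY] using abs_kernel_le_of_le_dist hs hc hk hε (le_of_lt hy)
  · simpa [hyY] using h0

theorem truncSing_union (μ : Measure X) [IsFiniteMeasure μ] (hs : 0 < s) (hc : 0 < c)
    (hkm : Measurable (Function.uncurry k))
    (hk : ∀ x y : X, x ≠ y → |k x y| ≤ c * (dist x y) ^ (-s)) {ε : ℝ} (hε : 0 < ε)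
    {Y Y' : Set X} (hY : MeasurableSet Y) (hY' : MeasurableSet Y') (hd : Disjoint Y Y') (x : X) :
    truncSing μ k ε (Y ∪ Y') x = truncSing μ k ε Y x + truncSing μ k ε Y' x := by
  rw [truncSing, truncSing, truncSing, ← integral_add
    (integrableOn_truncSing μ hs hc hkm hk hε hY x)
    (integrableOn_truncSing μ hs hc hkm hk hε hY' x)]
  congr 1
  ext y
  rw [indicator_union_of_disjoint hd]
  ring

theorem tendsto_integral_truncSing_self (μ : Measure X) [IsFiniteMeasure μ] {cμ : ℝ}
    (hcμ : 0 < cμ)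
    (hgrowth : ∀ (x : X) (t : ℝ), 0 < t → μ (closedBall x t) ≤ ENNReal.ofReal (cμ * t ^ s))
    (hs : 0 < s) (hc : 0 < c) (hkm : Measurable (Function.uncurry k))
    (hk : ∀ x y : X, x ≠ y → |k x y| ≤ c * (dist x y) ^ (-s))
    (hanti : ∀ x y : X, k x y = -k y x) {A : Set X} (hA : MeasurableSet A) :
    Tendsto (fun ε => ∫ x in A, truncSing μ k ε A x ∂μ) (𝓝[>] 0) (𝓝 0) := by
  choose! E hEm hEs hEfar hEsupp using fun (t : ℝ) (ht : 0 < t) =>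
    exists_symmetric_truncation μ ht
  let f : ℝ → X → X → ℝ := fun ε x y =>
    indicator (E ε ∩ {p | |k p.1 p.2| ≤ c * ε ^ (-s)}) (fun p => k p.1 p.2) (x, y)
  have hfm : ∀ ε > 0, Measurable (Function.uncurry (f ε)) := fun ε hε =>
    hkm.indicator ((hEm ε hε).inter (measurableSet_le hkm.abs measurable_const))
  have hfb : ∀ ε > 0, ∀ x y, |f ε x y| ≤ c * ε ^ (-s) := by
    intro ε hε x y
    by_cases h : (x, y) ∈ E ε ∩ {p | |k p.1 p.2| ≤ c * ε ^ (-s)}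
    · simp only [f, indicator_of_mem h]
      exact h.2
    · simp only [f, indicator_of_notMem h, abs_zero]
      positivity
  have hfa : ∀ ε > 0, ∀ x y, f ε x y = -f ε y x := by
    intro ε hε x y
    have hiff : (x, y) ∈ E ε ∩ {p | |k p.1 p.2| ≤ c * ε ^ (-s)} ↔
        (y, x) ∈ E ε ∩ {p | |k p.1 p.2| ≤ c * ε ^ (-s)} := by
      simp only [mem_inter_iff, mem_ofPred_eq, hEs ε hε x y, hanti x y, abs_neg]
    by_cases h : (x, y) ∈ E ε ∩ {p | |k p.1 p.2| ≤ c * ε ^ (-s)}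
    · simp only [f, indicator_of_mem h, indicator_of_mem (hiff.1 h)]
      exact hanti x y
    · simp only [f, indicator_of_notMem h, indicator_of_notMem (mt hiff.2 h), neg_zero]
  have hfi : ∀ ε > 0, ∀ x, Integrable (f ε x) (μ.restrict A) := fun ε hε x =>
    Integrable.of_bound ((hfm ε hε).comp measurable_prodMk_left).aestronglyMeasurable _
      (.of_forall (hfb ε hε x))
  have hFm : ∀ ε > 0, StronglyMeasurable fun x => ∫ y in A, f ε x y ∂μ := fun ε hε =>
    (hfm ε hε).stronglyMeasurable.integral_prod_right' (ν := μ.restrict A)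
  have hFi : ∀ ε > 0, Integrable (fun x => ∫ y in A, f ε x y ∂μ) (μ.restrict A) := fun ε hε =>
    Integrable.of_bound (hFm ε hε).aestronglyMeasurable _ (.of_forall fun x =>
      norm_setIntegral_le_of_norm_le_const (measure_lt_top _ _) fun y _ => hfb ε hε x y)
  have hdiff : ∀ ε > 0, ∀ x, truncSing μ k ε A x - ∫ y in A, f ε x y ∂μ =
      ∫ y in A, (indicator {y | ε < dist x y} (k x) y - f ε x y) ∂μ := by
    intro ε hε x
    have hcomm : truncSing μ k ε A x = ∫ y in A, indicator {y | ε < dist x y} (k x) y ∂μ := by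
      rw [truncSing, ← integral_indicator (measurableSet_dist_gt x ε), ← integral_indicator hA]
      congr 1
      ext y
      by_cases h1 : y ∈ A <;> by_cases h2 : y ∈ {y | ε < dist x y} <;> simp [h1, h2, indicator]
    rw [hcomm, integral_sub _ (hfi ε hε x)]
    refine Integrable.of_bound (C := c * ε ^ (-s)) ((hkm.comp measurable_prodMk_left).indicator
      (measurableSet_dist_gt x ε)).aestronglyMeasurable (.of_forall fun y => ?_)
    by_cases h : y ∈ {y | ε < dist x y}
    · rw [indicator_of_mem h]
      exact abs_kernel_le_of_le_dist hs hc hk hε (le_of_lt h)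
    · rw [indicator_of_notMem h, norm_zero]
      positivity
  have hzero : ∀ ε > 0, ∀ x y, ((x, y) ∈ E ε ↔ ε < dist x y) →
      indicator {y | ε < dist x y} (k x) y - f ε x y = 0 := by
    intro ε hε x y h
    by_cases hd : ε < dist x y
    · have hb := abs_kernel_le_of_le_dist hs hc hk hε hd.le
      simp [f, indicator, hd, h, hb]
    · simp [f, indicator, hd, h]
  have hbound : ∀ ε > 0, ∀ x, ‖truncSing μ k ε A x - ∫ y in A, f ε x y ∂μ‖ ≤
      2 * (c * ε ^ (-s)) * μ.real (closedBall x (20 * ε)) := by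
    intro ε hε x
    have h0 : 0 ≤ c * ε ^ (-s) := by positivity
    have hsub : ∀ y, y ∉ closedBall x (20 * ε) →
        indicator {y | ε < dist x y} (k x) y - f ε x y = 0 := by
      intro y hy
      rw [mem_closedBall, dist_comm, not_le] at hy
      exact hzero ε hε x y (iff_of_true (hEfar ε hε x y hy) (by linarith))
    rw [hdiff ε hε, ← setIntegral_eq_integral_of_forall_compl_eq_zero hsub]
    refine (norm_setIntegral_le_of_norm_le_const (C := 2 * (c * ε ^ (-s)))
      (measure_lt_top _ _) fun y _ => ?_).trans (mul_le_mul_of_nonneg_left ?_ (by linarith))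
    · refine (norm_sub_le _ _).trans ?_
      have h1 := hfb ε hε x y
      have h2 : ‖indicator {y | ε < dist x y} (k x) y‖ ≤ c * ε ^ (-s) := by
        by_cases h : y ∈ {y | ε < dist x y}
        · rw [indicator_of_mem h]
          exact abs_kernel_le_of_le_dist hs hc hk hε (le_of_lt h)
        · rwa [indicator_of_notMem h, norm_zero]
      rw [Real.norm_eq_abs (f ε x y)]
      linarith
    · exact ENNReal.toReal_mono (measure_ne_top _ _) (Measure.restrict_apply_le _ _)
  have hmain : Tendsto (fun ε => ∫ x in A, (truncSing μ k ε A x - ∫ y in A, f ε x y ∂μ) ∂μ)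
      (𝓝[>] 0) (𝓝 (∫ _ in A, (0 : ℝ) ∂μ)) := by
    refine tendsto_integral_filter_of_dominated_convergence
      (fun _ => 2 * c * (cμ * 20 ^ s)) ?_ ?_ (integrable_const _) ?_
    · filter_upwards [self_mem_nhdsWithin] with ε hε
      exact ((stronglyMeasurable_truncSing μ hkm ε hA).sub (hFm ε hε)).aestronglyMeasurable
    · filter_upwards [self_mem_nhdsWithin] with ε (hε : 0 < ε)
      refine .of_forall fun x => (hbound ε hε x).trans ?_
      have hball : μ.real (closedBall x (20 * ε)) ≤ cμ * (20 * ε) ^ s :=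
        ENNReal.toReal_le_of_le_ofReal (by positivity) (hgrowth x _ (by positivity))
      have hpow : ε ^ (-s) * ε ^ s = 1 := by
        rw [← Real.rpow_add hε, neg_add_cancel, Real.rpow_zero]
      calc 2 * (c * ε ^ (-s)) * μ.real (closedBall x (20 * ε))
          ≤ 2 * (c * ε ^ (-s)) * (cμ * (20 * ε) ^ s) := by gcongr
        _ = 2 * c * (cμ * 20 ^ s) * (ε ^ (-s) * ε ^ s) := by
          rw [Real.mul_rpow (by norm_num) hε.le]
          ring
        _ = 2 * c * (cμ * 20 ^ s) := by rw [hpow, mul_one]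
    · refine .of_forall fun x => tendsto_const_nhds.congr' ?_
      by_cases hx : ∀ t > 0, 0 < μ (ball x t)
      · filter_upwards [self_mem_nhdsWithin] with ε (hε : 0 < ε)
        rw [hdiff ε hε]
        simp [fun y => hzero ε hε x y (hEsupp ε hε x hx y)]
      · push Not at hx
        obtain ⟨t, ht, hxt⟩ := hx
        filter_upwards [Ioo_mem_nhdsGT (show 0 < t / 20 by positivity)] with ε hε
        have hnull : μ.real (closedBall x (20 * ε)) = 0 := by
          rw [measureReal_eq_zero_iff]
          exact measure_mono_null (closedBall_subset_ball (by linarith [hε.2]))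
            (le_antisymm hxt zero_le)
        have := hbound ε hε.1 x
        rw [hnull, mul_zero] at this
        exact (norm_le_zero_iff.1 this).symm
  rw [integral_zero] at hmain
  refine hmain.congr' ?_
  filter_upwards [self_mem_nhdsWithin] with ε hε
  rw [integral_sub (integrable_truncSing μ hs hc hkm hk hε hA).integrableOn (hFi ε hε),
    integral_integral_eq_zero_of_antisymm (μ.restrict A) (hfm ε hε) (hfb ε hε) (hfa ε hε), sub_zero]

theorem setLIntegral_enorm_kernel_le (μ : Measure X) [IsFiniteMeasure μ] {cμ : ℝ}
    (hgrowth : ∀ (x : X) (t : ℝ), 0 < t → μ (closedBall x t) ≤ ENNReal.ofReal (cμ * t ^ s))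
    (hs : 0 < s) (hc : 0 < c)
    (hk : ∀ x y : X, x ≠ y → |k x y| ≤ c * (dist x y) ^ (-s)) {a : ℝ} (ha0 : 0 < a) (ha1 : a < 1)
    (x : X) {δ : ℝ} (hδ : 0 < δ) :
    ∫⁻ y, indicator {y | δ ≤ dist x y} (fun y => ‖k x y‖ₑ) y ∂μ ≤
      ENNReal.ofReal c * (μ univ + ENNReal.ofReal (cμ * a ^ (-s)) *
        ∑' n : ℕ, indicator (Iic (a ^ n)) (fun _ => 1) δ) := by
  let u : ℕ → ENNReal := fun n => indicator (Iic (a ^ n)) (fun _ => 1) δ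
  let g : ℕ → X → ENNReal := fun n =>
    indicator (closedBall x (a ^ n)) fun _ => ENNReal.ofReal ((a ^ (n + 1)) ^ (-s))
  have hg : ∀ n, Measurable (g n) := fun n => measurable_const.indicator measurableSet_closedBall
  have hpt : ∀ y, indicator {y | δ ≤ dist x y} (fun y => ‖k x y‖ₑ) y ≤
      ENNReal.ofReal c * (1 + ∑' n, u n * g n y) := by
    intro y
    by_cases hy : y ∈ {y | δ ≤ dist x y}
    swap
    · rw [indicator_of_notMem hy]
      exact zero_le
    rw [indicator_of_mem hy]
    have hd : 0 < dist x y := hδ.trans_le hy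
    have h1 : ‖k x y‖ₑ ≤ ENNReal.ofReal c * ENNReal.ofReal (dist x y ^ (-s)) := by
      rw [← ENNReal.ofReal_mul hc.le, ← ofReal_norm]
      exact ENNReal.ofReal_le_ofReal (hk x y (dist_pos.1 hd))
    refine h1.trans (mul_le_mul_right ?_ _)
    rcases le_or_gt (dist x y) 1 with hle | hgt
    · obtain ⟨n, hn1, hn2⟩ := exists_nat_pow_near_of_lt_one hd hle ha0 ha1
      refine le_trans ?_ ((ENNReal.le_tsum n).trans le_add_self)
      have hu : u n = 1 := indicator_of_mem (mem_Iic.2 (le_trans hy hn2)) _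
      have hgn : g n y = ENNReal.ofReal ((a ^ (n + 1)) ^ (-s)) :=
        indicator_of_mem (by rwa [mem_closedBall, dist_comm]) _
      rw [hu, hgn, one_mul]
      exact ENNReal.ofReal_le_ofReal
        (Real.rpow_le_rpow_of_nonpos (by positivity) hn1.le (by linarith))
    · refine le_trans ?_ le_self_add
      rw [← ENNReal.ofReal_one]
      exact ENNReal.ofReal_le_ofReal (Real.rpow_le_one_of_one_le_of_nonpos hgt.le (by linarith))
  refine (lintegral_mono hpt).trans ?_
  rw [lintegral_const_mul _ (by fun_prop), lintegral_add_left measurable_const, lintegral_const,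
    one_mul, lintegral_tsum fun n => ((hg n).const_mul _).aemeasurable, ← ENNReal.tsum_mul_left]
  gcongr with n
  rw [lintegral_const_mul _ (hg n), lintegral_indicator_const measurableSet_closedBall, mul_comm]
  gcongr
  have han : 0 < a ^ n := by positivity
  calc ENNReal.ofReal ((a ^ (n + 1)) ^ (-s)) * μ (closedBall x (a ^ n))
      ≤ ENNReal.ofReal ((a ^ (n + 1)) ^ (-s)) * ENNReal.ofReal (cμ * (a ^ n) ^ s) := by
        gcongr
        exact hgrowth x _ han
    _ = ENNReal.ofReal (cμ * a ^ (-s)) := by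
        rw [← ENNReal.ofReal_mul (by positivity), pow_succ, Real.mul_rpow han.le ha0.le]
        congr 1
        have : (a ^ n) ^ (-s) * (a ^ n) ^ s = 1 := by
          rw [← Real.rpow_add han, neg_add_cancel, Real.rpow_zero]
        linear_combination (cμ * a ^ (-s)) * this

theorem exists_tendsto_integral_truncSing (μ : Measure X) [IsFiniteMeasure μ] {cμ : ℝ}
    (hgrowth : ∀ (x : X) (t : ℝ), 0 < t → μ (closedBall x t) ≤ ENNReal.ofReal (cμ * t ^ s))
    (hs : 0 < s) (hc : 0 < c) (hkm : Measurable (Function.uncurry k))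
    (hk : ∀ x y : X, x ≠ y → |k x y| ≤ c * (dist x y) ^ (-s)) {a b : ℝ} (ha0 : 0 < a)
    (ha1 : a < 1) (hb1 : b < 1) {p : X} {R : ℝ} (hb0 : 0 ≤ b)
    (hgood : ∀ n : ℕ, 1 ≤ n → μ {x | |R - dist p x| ≤ a ^ n} ≤ ENNReal.ofReal (b ^ n))
    {V Y : Set X} (hV : MeasurableSet V) (hY : MeasurableSet Y)
    (hVY : ∀ x ∈ V, ∀ y ∈ Y, |R - dist p x| ≤ dist x y) :
    ∃ L, Tendsto (fun ε => ∫ x in V, truncSing μ k ε Y x ∂μ) (𝓝[>] 0) (𝓝 L) := by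
  have hδ : Continuous fun x => |R - dist p x| := by fun_prop
  let u : X → ENNReal := fun x =>
    ∑' n : ℕ, indicator (Iic (a ^ n)) (fun _ => 1) |R - dist p x|
  let G : X → ENNReal := fun x =>
    ENNReal.ofReal c * (μ univ + ENNReal.ofReal (cμ * a ^ (-s)) * u x)
  have hum : ∀ n : ℕ, Measurable fun x =>
      indicator (Iic (a ^ n)) (fun _ => (1 : ENNReal)) |R - dist p x| := fun n =>
    (measurable_const.indicator measurableSet_Iic).comp hδ.measurable
  have hu : Measurable u := Measurable.tsum hum
  have hGm : Measurable G := by fun_prop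
  have hlevel : ∀ n : ℕ, ∫⁻ x, indicator (Iic (a ^ n)) (fun _ => 1) |R - dist p x| ∂μ ≤
      (μ univ + 1) * ENNReal.ofReal b ^ n := by
    intro n
    have heq : (fun x => indicator (Iic (a ^ n)) (fun _ => (1 : ENNReal)) |R - dist p x|) =
        indicator {x | |R - dist p x| ≤ a ^ n} 1 := rfl
    rw [heq]
    refine (lintegral_indicator_one (hδ.measurable measurableSet_Iic)).trans_le ?_
    change μ {x | |R - dist p x| ≤ a ^ n} ≤ _
    rcases Nat.eq_zero_or_pos n with rfl | hn
    · rw [pow_zero (ENNReal.ofReal b), mul_one]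
      exact (measure_mono (subset_univ _)).trans le_self_add
    · refine (hgood n hn).trans ?_
      rw [ENNReal.ofReal_pow hb0]
      exact le_mul_of_one_le_left' le_add_self
  have hui : ∫⁻ x, u x ∂μ ≠ ⊤ := by
    rw [lintegral_tsum fun n => (hum n).aemeasurable]
    refine ne_top_of_le_ne_top ?_ (ENNReal.tsum_le_tsum hlevel)
    rw [ENNReal.tsum_mul_left, ENNReal.tsum_geometric]
    refine ENNReal.mul_ne_top (by simp) (ENNReal.inv_ne_top.2 ?_)
    exact (tsub_pos_of_lt (ENNReal.ofReal_lt_one.2 hb1)).ne'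
  have hGi : ∫⁻ x, G x ∂μ ≠ ⊤ := by
    rw [lintegral_const_mul _ (by fun_prop), lintegral_add_left measurable_const, lintegral_const,
      lintegral_const_mul _ hu]
    exact ENNReal.mul_ne_top ENNReal.ofReal_ne_top (ENNReal.add_ne_top.2
      ⟨ENNReal.mul_ne_top (measure_ne_top _ _) (measure_ne_top _ _),
        ENNReal.mul_ne_top ENNReal.ofReal_ne_top hui⟩)
  have hpos : ∀ᵐ x ∂μ, 0 < |R - dist p x| := by
    filter_upwards [ae_lt_top hu hui] with x hx
    refine (abs_nonneg _).lt_of_ne fun h => hx.ne ?_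
    have hone : ∀ n : ℕ, indicator (Iic (a ^ n)) (fun _ => (1 : ENNReal)) |R - dist p x| = 1 :=
      fun n => indicator_of_mem (mem_Iic.2 (by rw [← h]; positivity)) _
    simp only [u, hone]
    exact ENNReal.tsum_const_eq_top_of_ne_zero one_ne_zero
  refine ⟨∫ x in V, (∫ y, k x y * indicator Y (fun _ => (1 : ℝ)) y ∂μ) ∂μ,
    tendsto_integral_filter_of_dominated_convergence (fun x => (G x).toReal) ?_ ?_ ?_ ?_⟩
  · exact .of_forall fun ε => (stronglyMeasurable_truncSing μ hkm ε hY).aestronglyMeasurable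
  · refine .of_forall fun ε => ?_
    filter_upwards [ae_restrict_mem hV, ae_restrict_of_ae hpos,
      ae_restrict_of_ae (ae_lt_top hGm hGi)] with x hxV hx hGx
    rw [← toReal_enorm]
    refine ENNReal.toReal_mono hGx.ne ?_
    refine (enorm_integral_le_lintegral_enorm _).trans ((setLIntegral_le_lintegral _ _).trans
      (le_trans (lintegral_mono fun y => ?_)
        (setLIntegral_enorm_kernel_le μ hgrowth hs hc hk ha0 ha1 x hx)))
    by_cases hy : y ∈ Y
    · have : y ∈ {y | |R - dist p x| ≤ dist x y} := hVY x hxV y hy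
      simp [hy, indicator_of_mem this]
    · simp [hy]
  · exact (integrable_toReal_of_lintegral_ne_top hGm.aemeasurable hGi).integrableOn
  · filter_upwards [ae_restrict_mem hV, ae_restrict_of_ae hpos] with x hxV hx
    refine tendsto_const_nhds.congr' ?_
    filter_upwards [Ioo_mem_nhdsGT hx] with ε hε
    refine (setIntegral_eq_integral_of_forall_compl_eq_zero fun y hy => ?_).symm
    have hyY : y ∉ Y := fun h => hy (hε.2.trans_le (hVY x hxV y h))
    simp [hyY]

theorem exists_tendsto_integral_truncSing_of_good (μ : Measure X) [IsFiniteMeasure μ] {cμ : ℝ}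
    (hcμ : 0 < cμ)
    (hgrowth : ∀ (x : X) (t : ℝ), 0 < t → μ (closedBall x t) ≤ ENNReal.ofReal (cμ * t ^ s))
    (hs : 0 < s) (hc : 0 < c) (hkm : Measurable (Function.uncurry k))
    (hk : ∀ x y : X, x ≠ y → |k x y| ≤ c * (dist x y) ^ (-s))
    (hanti : ∀ x y : X, k x y = -k y x) {z w : X} {r ρ : ℝ} {a b a' b' : ℝ}
    (ha0 : 0 < a) (ha1 : a < 1) (hb0 : 0 ≤ b) (hb1 : b < 1)
    (ha0' : 0 < a') (ha1' : a' < 1) (hb0' : 0 ≤ b') (hb1' : b' < 1)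
    (hgoodr : ∀ n : ℕ, 1 ≤ n → μ {x | |r - dist z x| ≤ a ^ n} ≤ ENNReal.ofReal (b ^ n))
    (hgoodρ : ∀ n : ℕ, 1 ≤ n → μ {x | |ρ - dist w x| ≤ a' ^ n} ≤ ENNReal.ofReal (b' ^ n)) :
    ∃ L, Tendsto (fun ε => ∫ x in closedBall w ρ, truncSing μ k ε (closedBall z r) x ∂μ)
      (𝓝[>] 0) (𝓝 L) := by
  have hW : MeasurableSet (closedBall w ρ) := measurableSet_closedBall
  have hZ : MeasurableSet (closedBall z r) := measurableSet_closedBall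
  have hWZ := hW.inter hZ
  obtain ⟨L₁, hL₁⟩ := exists_tendsto_integral_truncSing μ hgrowth hs hc hkm hk ha0' ha1' hb1' hb0'
    hgoodρ hWZ (hZ.diff hW) fun x hx y hy => by
      have hx' := hx.1
      have hy' := hy.2
      rw [mem_closedBall, dist_comm] at hx' hy'
      rw [abs_of_nonneg (by linarith)]
      linarith [dist_triangle w x y]
  obtain ⟨L₂, hL₂⟩ := exists_tendsto_integral_truncSing μ hgrowth hs hc hkm hk ha0 ha1 hb1 hb0
    hgoodr (hW.diff hZ) hZ fun x hx y hy => by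
      have hx' := hx.2
      rw [mem_closedBall, dist_comm] at hx' hy
      rw [abs_of_nonpos (by linarith)]
      linarith [dist_triangle_right z x y]
  have hL₀ := tendsto_integral_truncSing_self μ hcμ hgrowth hs hc hkm hk hanti hWZ
  refine ⟨0 + L₁ + L₂, ((hL₀.add hL₁).add hL₂).congr' ?_⟩
  filter_upwards [self_mem_nhdsWithin] with ε hε
  have hint : ∀ {Y : Set X}, MeasurableSet Y → Integrable (truncSing μ k ε Y) μ := fun hY =>
    integrable_truncSing μ hs hc hkm hk hε hY
  have hunion : closedBall w ρ ∩ closedBall z r ∪ closedBall z r \ closedBall w ρ =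
      closedBall z r := by
    rw [inter_comm, inter_union_sdiff]
  have hsplit : ∫ x in closedBall w ρ ∩ closedBall z r, truncSing μ k ε (closedBall z r) x ∂μ =
      ∫ x in closedBall w ρ ∩ closedBall z r,
        truncSing μ k ε (closedBall w ρ ∩ closedBall z r) x ∂μ +
      ∫ x in closedBall w ρ ∩ closedBall z r,
        truncSing μ k ε (closedBall z r \ closedBall w ρ) x ∂μ := by
    rw [← integral_add (hint hWZ).integrableOn (hint (hZ.diff hW)).integrableOn]
    refine setIntegral_congr_fun hWZ fun x _ => ?_
    have := truncSing_union μ hs hc hkm hk hε hWZ (hZ.diff hW)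
      (disjoint_sdiff_right.mono_left inter_subset_left) x
    rwa [hunion] at this
  rw [← hsplit, integral_inter_add_sdiff hZ (hint hZ).integrableOn]

end Bounds

end TruncatedKernels

/-- Let `μ` be a finite Borel measure with `s`-growth on a metric space `X` and `k` an
antisymmetric `s`-dimensional kernel. If `r, ρ ∈ (0,1]` are `λ`-good resp. `λ'`-good
radii for `μ` at `z` resp. `w` (integers `λ, λ' > 2`), then the limit
`lim_{ε → 0⁺} ∫_{B(w,ρ)} T^k_{μ,ε}(χ_{B(z,r)})(x) dμ(x)` exists, where
`T^k_{μ,ε}(f)(x) = ∫_{{y : d(x,y) > ε}} k(x,y) f(y) dμ(y)`. -/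
theorem stmt10 {X : Type*} [MetricSpace X] [MeasurableSpace X] [BorelSpace X]
    (s : ℝ) (hs : 0 < s) (μ : Measure X) [IsFiniteMeasure μ]
    (cμ : ℝ) (hcμ : 0 < cμ)
    (hgrowth : ∀ (x : X) (ρ' : ℝ), 0 < ρ' →
      μ (Metric.closedBall x ρ') ≤ ENNReal.ofReal (cμ * ρ' ^ s))
    (k : X → X → ℝ) (hkmeas : Measurable (Function.uncurry k))
    (c : ℝ) (hc : 0 < c)
    (hk : ∀ x y : X, x ≠ y → |k x y| ≤ c * (dist x y) ^ (-s))
    (hanti : ∀ x y : X, x ≠ y → k x y = - k y x)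
    (z w : X) (r ρ : ℝ) (hr0 : 0 < r) (hr1 : r ≤ 1) (hρ0 : 0 < ρ) (hρ1 : ρ ≤ 1)
    (l l' : ℤ) (hl : 2 < l) (hl' : 2 < l')
    (hgoodr : ∀ n : ℕ, 1 ≤ n →
      μ {x : X | r - (l : ℝ) ^ (-(3 * n : ℤ)) ≤ dist z x ∧
          dist z x ≤ r + (l : ℝ) ^ (-(3 * n : ℤ))} ≤
        ENNReal.ofReal ((l : ℝ) ^ (-(n : ℤ))))
    (hgoodρ : ∀ n : ℕ, 1 ≤ n →
      μ {x : X | ρ - (l' : ℝ) ^ (-(3 * n : ℤ)) ≤ dist w x ∧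
          dist w x ≤ ρ + (l' : ℝ) ^ (-(3 * n : ℤ))} ≤
        ENNReal.ofReal ((l' : ℝ) ^ (-(n : ℤ)))) :
    ∃ L : ℝ, Filter.Tendsto
      (fun ε : ℝ =>
        ∫ x in Metric.closedBall w ρ,
          (∫ y in {y : X | ε < dist x y},
            k x y * Set.indicator (Metric.closedBall z r) (fun _ => (1 : ℝ)) y ∂μ) ∂μ)
      (𝓝[>] (0 : ℝ)) (𝓝 L) := by
  have hgood : ∀ (m : ℤ) (p : X) (R : ℝ), 2 < m →
      (∀ n : ℕ, 1 ≤ n → μ {x : X | R - (m : ℝ) ^ (-(3 * n : ℤ)) ≤ dist p x ∧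
          dist p x ≤ R + (m : ℝ) ^ (-(3 * n : ℤ))} ≤ ENNReal.ofReal ((m : ℝ) ^ (-(n : ℤ)))) →
      0 < ((m : ℝ) ^ 3)⁻¹ ∧ ((m : ℝ) ^ 3)⁻¹ < 1 ∧ 0 ≤ (m : ℝ)⁻¹ ∧ (m : ℝ)⁻¹ < 1 ∧
      ∀ n : ℕ, 1 ≤ n → μ {x | |R - dist p x| ≤ (((m : ℝ) ^ 3)⁻¹) ^ n} ≤
        ENNReal.ofReal (((m : ℝ)⁻¹) ^ n) := by
    intro m p R hm hR
    have hm' : (2 : ℝ) < m := by exact_mod_cast hm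
    refine ⟨by positivity, inv_lt_one_of_one_lt₀ (one_lt_pow₀ (by linarith) (by norm_num)),
      by positivity, inv_lt_one_of_one_lt₀ (by linarith), fun n hn => ?_⟩
    have h1 : (m : ℝ) ^ (-(3 * n : ℤ)) = (((m : ℝ) ^ 3)⁻¹) ^ n := by
      rw [zpow_neg, zpow_mul, inv_pow]
      norm_cast
    have h2 : (m : ℝ) ^ (-(n : ℤ)) = ((m : ℝ)⁻¹) ^ n := by
      rw [zpow_neg, inv_pow, zpow_natCast]
    have h := hR n hn
    rw [h1, h2] at h
    refine (measure_mono fun x hx => ?_).trans h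
    have hx' := abs_le.1 (show |R - dist p x| ≤ (((m : ℝ) ^ 3)⁻¹) ^ n from hx)
    exact ⟨by linarith [hx'.2], by linarith [hx'.1]⟩
  obtain ⟨ha0, ha1, hb0, hb1, hr⟩ := hgood l z r hl hgoodr
  obtain ⟨ha0', ha1', hb0', hb1', hρ⟩ := hgood l' w ρ hl' hgoodρ
  let k' : X → X → ℝ := fun x y => (k x y - k y x) / 2
  have hkk' : ∀ x y, x ≠ y → k' x y = k x y := fun x y hxy => by
    simp only [k']
    linarith [hanti x y hxy]
  have hk'm : Measurable (Function.uncurry k') :=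
    (hkmeas.sub (hkmeas.comp measurable_swap)).div_const 2
  obtain ⟨L, hL⟩ := exists_tendsto_integral_truncSing_of_good μ hcμ hgrowth hs hc hk'm
    (fun x y hxy => (hkk' x y hxy).symm ▸ hk x y hxy) (fun x y => by simp only [k']; ring)
    ha0 ha1 hb0 hb1 ha0' ha1' hb0' hb1' hr hρ
  refine ⟨L, hL.congr' ?_⟩
  filter_upwards [self_mem_nhdsWithin] with ε (hε : 0 < ε)
  congr 1
  ext x
  refine setIntegral_congr_fun (measurableSet_dist_gt x ε) fun y hy => ?_
  simp only [hkk' x y (dist_pos.1 (hε.trans hy))]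
end

section
/- Let (X,d) be a metric space, let s > 0, let μ be a finite Borel measure on X with s-growth, and let k be an antisymmetric s-dimensional kernel on X. Let f and g be finite linear combinations of indicator functions of closed balls whose centers lie in X and whose radii are good radii for μ at the corresponding centers (i.e., f = ∑_{i=1}^n a_i χ_{B(z_i,r_i)} and g = ∑_{j=1}^m b_j χ_{B(w_j,ρ_j)} with a_i, b_j ∈ ℝ, and each r_i ∈ (0,1] λ_i-good for μ at z_i and each ρ_j ∈ (0,1] λ'_j-good for μ at w_j, for some integers λ_i, λ'_j > 2). Then the limit lim_{ε → 0⁺} ∫ T^k_{μ,ε}(f)(x) g(x) dμ(x) exists. -/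
open MeasureTheory Set Filter Metric Topology

/-- The measure of the complement of a closed ball of fixed radius, intersected with a fixed set,
is a lower semicontinuous function of the center. -/
lemma lowerSemicontinuous_measure_inter_lt_dist {X : Type*} [PseudoMetricSpace X]
    [MeasurableSpace X] (μ : Measure X) (s : Set X) (ε : ℝ) :
    LowerSemicontinuous fun x => μ (s ∩ {y | ε < dist x y}) := by
  intro x t ht
  have hU : s ∩ {y | ε < dist x y} = ⋃ n : ℕ, s ∩ {y | ε + 1 / ((n : ℝ) + 1) < dist x y} := by
    ext y
    simp only [mem_inter_iff, mem_ofPred_eq, mem_iUnion]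
    constructor
    · rintro ⟨hy, h⟩
      obtain ⟨n, hn⟩ := exists_nat_one_div_lt (sub_pos.2 h)
      exact ⟨n, hy, by linarith⟩
    · rintro ⟨n, hy, h⟩
      have : (0 : ℝ) < 1 / ((n : ℝ) + 1) := by positivity
      exact ⟨hy, by linarith⟩
  have hmono : Monotone fun n : ℕ => s ∩ {y | ε + 1 / ((n : ℝ) + 1) < dist x y} := by
    intro i j hij y hy
    have := Nat.one_div_le_one_div (α := ℝ) hij
    have h : ε + 1 / ((j : ℝ) + 1) ≤ ε + 1 / ((i : ℝ) + 1) := by linarith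
    exact ⟨hy.1, h.trans_lt hy.2⟩
  change t < μ (s ∩ {y | ε < dist x y}) at ht
  rw [hU, hmono.measure_iUnion, lt_iSup_iff] at ht
  obtain ⟨n, hn⟩ := ht
  filter_upwards [Metric.ball_mem_nhds x (show (0 : ℝ) < 1 / ((n : ℝ) + 1) by positivity)]
    with x' hx'
  refine hn.trans_le (measure_mono fun y hy => ⟨hy.1, ?_⟩)
  have h1 : ε + 1 / ((n : ℝ) + 1) < dist x y := hy.2
  have h2 := dist_triangle x x' y
  rw [mem_ball'] at hx'
  change ε < dist x' y
  linarith

/-- Truncated integrals of a product measurable kernel are measurable, even if the metric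
itself is not product measurable. -/
lemma stronglyMeasurable_truncated_integral {X : Type*} [PseudoMetricSpace X]
    [MeasurableSpace X] [BorelSpace X] (μ : Measure X) [IsFiniteMeasure μ] {K : X → X → ℝ}
    (hK : Measurable (Function.uncurry K)) (ε : ℝ) :
    StronglyMeasurable fun x => ∫ y in {y | ε < dist x y}, K x y ∂μ := by
  let κ : ProbabilityTheory.Kernel X X :=
    { toFun := fun x => μ.restrict {y | ε < dist x y}
      measurable' := by
        refine Measure.measurable_of_measurable_coe _ fun s hs => ?_
        simp only [Measure.restrict_apply hs]
        exact (lowerSemicontinuous_measure_inter_lt_dist μ s ε).measurable }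
  have : ProbabilityTheory.IsFiniteKernel κ :=
    ⟨μ univ, measure_lt_top _ _, fun x => Measure.restrict_apply_le _ _⟩
  exact StronglyMeasurable.integral_kernel_prod_right' (κ := κ) hK.stronglyMeasurable

/-- For a finite measure, there is a countable set that is `2δ`-close to every point whose closed
`δ`-ball has positive measure. -/
lemma exists_countable_near_of_measure_closedBall_pos {X : Type*} [PseudoMetricSpace X]
    [MeasurableSpace X] [OpensMeasurableSpace X] (μ : Measure X) [IsFiniteMeasure μ] (δ : ℝ)
    (hδ : 0 ≤ δ) :
    ∃ Q : Set X, Q.Countable ∧ ∀ x, 0 < μ (closedBall x δ) → ∃ q ∈ Q, dist x q ≤ 2 * δ := by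
  obtain ⟨Q, hQ⟩ := zorn_subset
    {N : Set X | (∀ x ∈ N, 0 < μ (closedBall x δ)) ∧ N.Pairwise fun x y => 2 * δ < dist x y} (by
      intro c hc hchain
      refine ⟨⋃₀ c, ⟨?_, ?_⟩, fun s hs => subset_sUnion_of_mem hs⟩
      · rintro x ⟨N, hN, hx⟩
        exact (hc hN).1 x hx
      · exact (pairwise_sUnion hchain.directedOn).2 fun N hN => (hc hN).2)
  refine ⟨Q, ?_, fun x hx => ?_⟩
  · have h := Measure.countable_meas_pos_of_disjoint_iUnion (μ := μ)
      (As := fun q : Q => closedBall (q : X) δ) (fun _ => isClosed_closedBall.measurableSet) (by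
        intro p q hpq
        refine closedBall_disjoint_closedBall ?_
        have := hQ.prop.2 p.2 q.2 (fun h => hpq (Subtype.ext h))
        linarith)
    have hu : {q : Q | 0 < μ (closedBall (q : X) δ)} = univ :=
      eq_univ_of_forall fun q => hQ.prop.1 q q.2
    rw [hu] at h
    exact countable_coe_iff.1 (countable_univ_iff.1 h)
  · by_contra! hfar
    have hmem : insert x Q ∈
        {N : Set X | (∀ x ∈ N, 0 < μ (closedBall x δ)) ∧ N.Pairwise fun x y => 2 * δ < dist x y} :=
      ⟨by rintro y (rfl | hy); exacts [hx, hQ.prop.1 y hy],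
        hQ.prop.2.insert fun y hy _ => ⟨hfar y hy, by rw [dist_comm]; exact hfar y hy⟩⟩
    have hxQ : x ∈ Q := hQ.le_of_ge hmem (subset_insert x Q) (mem_insert x Q)
    have := hfar x hxQ
    rw [dist_self] at this
    linarith

/-- On a nonempty metric space with a finite Borel measure there is a product measurable
symmetric function `D ≥ dist`, and a function `ψ` such that `D ≤ dist + 2ψ` and
`ψ x ≤ 4 dist x y` for almost every `y`. If the space is separable one can take `D = dist`. -/
lemma exists_measurable_dist_majorant {X : Type*} [PseudoMetricSpace X] [Nonempty X]
    [MeasurableSpace X] [OpensMeasurableSpace X] (μ : Measure X) [IsFiniteMeasure μ] :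
    ∃ (D : X → X → ℝ) (ψ : X → ℝ), Measurable (Function.uncurry D) ∧ (∀ x y, D x y = D y x) ∧
      (∀ x y, dist x y ≤ D x y) ∧ (∀ x, 0 ≤ ψ x) ∧ (∀ x y, D x y ≤ dist x y + 2 * ψ x) ∧
      ∀ x, ∀ᵐ y ∂μ, ψ x ≤ 4 * dist x y := by
  choose Q' hQ'c hQ' using fun δ : {q : ℚ // 0 < q} =>
    exists_countable_near_of_measure_closedBall_pos μ ((δ : ℚ) : ℝ)
      (by exact_mod_cast δ.2.le)
  obtain ⟨x₀⟩ := ‹Nonempty X›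
  set Q : Set X := insert x₀ (⋃ δ, Q' δ) with hQdef
  have hQc : Q.Countable := (countable_iUnion hQ'c).insert _
  have hQne : Q.Nonempty := insert_nonempty _ _
  have : Countable Q := hQc.to_subtype
  have : Nonempty Q := hQne.to_subtype
  have hbdd : ∀ x y : X, BddBelow (range fun q : Q => dist x q + dist (q : X) y) := fun x y =>
    ⟨0, by rintro _ ⟨q, rfl⟩; positivity⟩
  refine ⟨fun x y => ⨅ q : Q, (dist x q + dist (q : X) y), fun x => infDist x Q, ?_, ?_, ?_,
    fun x => infDist_nonneg, ?_, ?_⟩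
  · refine Measurable.iInf fun q => ?_
    exact ((continuous_id.dist continuous_const).measurable.comp measurable_fst).add
      ((continuous_const.dist continuous_id).measurable.comp measurable_snd)
  · intro x y
    refine iInf_congr fun q => ?_
    rw [dist_comm x, dist_comm _ y, add_comm]
  · exact fun x y => le_ciInf fun q => dist_triangle _ _ _
  · intro x y
    refine le_of_forall_pos_le_add fun e he => ?_
    obtain ⟨q, hq, hxq⟩ := (infDist_lt_iff hQne).1
      (show infDist x Q < infDist x Q + e / 2 by linarith)
    have h1 := ciInf_le (hbdd x y) ⟨q, hq⟩
    have h2 := dist_triangle q x y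
    rw [dist_comm q x] at h2
    simp only at h1 ⊢
    linarith
  · intro x
    have hball : μ (ball x (infDist x Q / 4)) = 0 := by
      by_contra hne
      have hpos : 0 < μ (ball x (infDist x Q / 4)) := pos_iff_ne_zero.2 hne
      have hψ : 0 < infDist x Q := by
        by_contra! h
        rw [ball_eq_empty.2 (by linarith)] at hne
        simp at hne
      obtain ⟨q, hq1, hq2⟩ := exists_rat_btwn (show infDist x Q / 4 < infDist x Q / 2 by linarith)
      have hq0 : 0 < q := by
        have : (0 : ℝ) < q := by linarith
        exact_mod_cast this
      obtain ⟨p, hp, hxp⟩ := hQ' ⟨q, hq0⟩ x (hpos.trans_le (measure_mono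
        (ball_subset_closedBall.trans (closedBall_subset_closedBall hq1.le))))
      have hpQ : p ∈ Q := mem_insert_of_mem _ (mem_iUnion.2 ⟨_, hp⟩)
      have := infDist_le_dist_of_mem (x := x) hpQ
      simp only at hxp
      linarith
    rw [ae_iff]
    convert hball using 2
    ext y
    simp only [mem_ofPred_eq, not_le, mem_ball']
    constructor <;> intro h <;> linarith

lemma rpow_neg_le_rpow_neg_of_le {a b p : ℝ} (ha : 0 < a) (hab : a ≤ b) (hp : 0 ≤ p) :
    b ^ (-p) ≤ a ^ (-p) :=
  Real.rpow_le_rpow_of_nonpos ha hab (neg_nonpos.2 hp)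

/-- A kernel of size at most `C d^{-s}` is integrable away from the diagonal. -/
lemma integrableOn_lt_dist_of_abs_le {X : Type*} [PseudoMetricSpace X]
    [MeasurableSpace X] [BorelSpace X] (μ : Measure X) [IsFiniteMeasure μ] {K : X → X → ℝ}
    (hK : Measurable (Function.uncurry K)) {s C : ℝ} (hs : 0 < s) (hC : 0 ≤ C)
    (hKb : ∀ x y, |K x y| ≤ C * dist x y ^ (-s)) {ε : ℝ} (hε : 0 < ε) (x : X) :
    IntegrableOn (K x) {y | ε < dist x y} μ := by
  have hmeas : MeasurableSet {y | ε < dist x y} :=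
    (isOpen_lt continuous_const (continuous_const.dist continuous_id)).measurableSet
  refine Integrable.of_bound (hK.of_uncurry_left).aestronglyMeasurable (C * ε ^ (-s)) ?_
  filter_upwards [ae_restrict_mem hmeas] with y hy
  exact (hKb x y).trans
    (mul_le_mul_of_nonneg_left (rpow_neg_le_rpow_neg_of_le hε (le_of_lt hy) hs.le) hC)

lemma integrable_truncated_integral {X : Type*} [PseudoMetricSpace X]
    [MeasurableSpace X] [BorelSpace X] (μ : Measure X) [IsFiniteMeasure μ] {K : X → X → ℝ}
    (hK : Measurable (Function.uncurry K)) {s C : ℝ} (hs : 0 < s) (hC : 0 ≤ C)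
    (hKb : ∀ x y, |K x y| ≤ C * dist x y ^ (-s)) {ε : ℝ} (hε : 0 < ε) :
    Integrable (fun x => ∫ y in {y | ε < dist x y}, K x y ∂μ) μ := by
  refine Integrable.of_bound
    (stronglyMeasurable_truncated_integral μ hK ε).aestronglyMeasurable
    (C * ε ^ (-s) * μ.real univ) (Eventually.of_forall fun x => ?_)
  refine (norm_setIntegral_le_of_norm_le_const (measure_lt_top _ _) fun y hy =>
    (hKb x y).trans (mul_le_mul_of_nonneg_left
      (rpow_neg_le_rpow_neg_of_le hε (le_of_lt hy) hs.le) hC)).trans ?_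
  exact mul_le_mul_of_nonneg_left (measureReal_mono (subset_univ _)) (by positivity)

/-- The truncated double integrals of an antisymmetric kernel tend to zero. They need not vanish
when the metric is not product measurable. -/
lemma tendsto_truncated_integral_of_antisymm {X : Type*} [PseudoMetricSpace X]
    [MeasurableSpace X] [BorelSpace X] (μ : Measure X) [IsFiniteMeasure μ] {K : X → X → ℝ}
    (hK : Measurable (Function.uncurry K)) {s C cμ : ℝ} (hs : 0 < s) (hC : 0 ≤ C) (hcμ : 0 ≤ cμ)
    (hgrowth : ∀ (x : X) (t : ℝ), 0 < t → μ (closedBall x t) ≤ ENNReal.ofReal (cμ * t ^ s))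
    (hKb : ∀ x y, |K x y| ≤ C * dist x y ^ (-s)) (hanti : ∀ x y, K x y = -K y x) :
    Tendsto (fun ε : ℝ => ∫ x, ∫ y in {y | ε < dist x y}, K x y ∂μ ∂μ) (𝓝[>] 0) (𝓝 0) := by
  rcases isEmpty_or_nonempty X with hX | hX
  · have : μ = 0 := Subsingleton.elim _ _
    simp [this]
  obtain ⟨D, ψ, hDm, hDsymm, hdD, hψ0, hDψ, hψ⟩ := exists_measurable_dist_majorant μ
  have hD9 : ∀ x, ∀ᵐ y ∂μ, D x y ≤ 9 * dist x y := fun x => by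
    filter_upwards [hψ x] with y hy
    linarith [hDψ x y]
  have hKae : ∀ ε > 0, ∀ x, ∀ᵐ y ∂μ, ε < D x y → |K x y| ≤ C * (ε / 9) ^ (-s) := by
    intro ε hε x
    filter_upwards [hD9 x] with y hy h
    exact (hKb x y).trans (mul_le_mul_of_nonneg_left
      (rpow_neg_le_rpow_neg_of_le (by positivity) (by linarith) hs.le) hC)
  have hDset : ∀ ε, MeasurableSet {p : X × X | ε < D p.1 p.2} := fun ε =>
    measurableSet_lt measurable_const hDm
  have hDset' : ∀ ε x, MeasurableSet {y | ε < D x y} := fun ε x =>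
    measurableSet_lt measurable_const hDm.of_uncurry_left
  have hdset : ∀ (ε : ℝ) (x : X), MeasurableSet {y | ε < dist x y} := fun ε x =>
    (isOpen_lt continuous_const (continuous_const.dist continuous_id)).measurableSet
  have hFm : ∀ ε, Measurable
      ({p : X × X | ε < D p.1 p.2}.indicator (Function.uncurry K)) := fun ε =>
    hK.indicator (hDset ε)
  have hF : ∀ ε > 0, Integrable ({p : X × X | ε < D p.1 p.2}.indicator (Function.uncurry K))
      (μ.prod μ) := by
    intro ε hε
    refine Integrable.of_bound (hFm ε).aestronglyMeasurable (C * (ε / 9) ^ (-s)) ?_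
    rw [Measure.ae_prod_iff_ae_ae
      (measurableSet_le (hFm ε).norm measurable_const)]
    refine Eventually.of_forall fun x => ?_
    filter_upwards [hKae ε hε x] with y hy
    by_cases h : ε < D x y
    · simpa [indicator, h] using hy h
    · simp only [indicator, mem_ofPred_eq, h, if_false, norm_zero]
      positivity
  have hFi : ∀ ε x, ∫ y, {p : X × X | ε < D p.1 p.2}.indicator (Function.uncurry K) (x, y) ∂μ =
      ∫ y in {y | ε < D x y}, K x y ∂μ := by
    intro ε x
    rw [← integral_indicator (hDset' ε x)]
    rfl
  have hDint : ∀ ε > 0, Integrable (fun x => ∫ y in {y | ε < D x y}, K x y ∂μ) μ := by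
    intro ε hε
    simpa only [hFi] using (hF ε hε).integral_prod_left
  have hDzero : ∀ ε > 0, ∫ x, ∫ y in {y | ε < D x y}, K x y ∂μ ∂μ = 0 := by
    intro ε hε
    have hswap := integral_integral_swap (f := fun x y =>
      {p : X × X | ε < D p.1 p.2}.indicator (Function.uncurry K) (x, y)) (hF ε hε)
    have hneg : ∀ x y, {p : X × X | ε < D p.1 p.2}.indicator (Function.uncurry K) (x, y) =
        -{p : X × X | ε < D p.1 p.2}.indicator (Function.uncurry K) (y, x) := by
      intro x y
      simp only [indicator, mem_ofPred_eq, hDsymm x y, Function.uncurry_apply_pair]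
      split_ifs
      · exact hanti x y
      · simp
    have hneg' : ∫ y, ∫ x, {p : X × X | ε < D p.1 p.2}.indicator (Function.uncurry K) (x, y) ∂μ ∂μ
        = -∫ y, ∫ x, {p : X × X | ε < D p.1 p.2}.indicator (Function.uncurry K) (y, x) ∂μ ∂μ := by
      rw [← integral_neg]
      refine integral_congr_ae (Eventually.of_forall fun y => ?_)
      simp only
      rw [← integral_neg]
      exact integral_congr_ae (Eventually.of_forall fun x => hneg x y)
    rw [hneg'] at hswap
    simp only [hFi] at hswap
    linarith
  have hTint : ∀ ε > 0, Integrable (fun x => ∫ y in {y | ε < dist x y}, K x y ∂μ) μ :=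
    fun ε hε => integrable_truncated_integral μ hK hs hC hKb hε
  have herr : Tendsto (fun ε : ℝ => ∫ x, ((∫ y in {y | ε < dist x y}, K x y ∂μ) -
      ∫ y in {y | ε < D x y}, K x y ∂μ) ∂μ) (𝓝[>] 0) (𝓝 (∫ _, (0 : ℝ) ∂μ)) := by
    refine tendsto_integral_filter_of_dominated_convergence
      (fun _ => C * 9 ^ s * cμ) ?_ ?_ (integrable_const _) ?_
    · filter_upwards [self_mem_nhdsWithin] with ε hε
      exact ((hTint ε hε).sub (hDint ε hε)).aestronglyMeasurable
    · filter_upwards [self_mem_nhdsWithin] with ε hε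
      replace hε : 0 < ε := hε
      refine Eventually.of_forall fun x => ?_
      have hsub : {y | ε < dist x y} ⊆ {y | ε < D x y} := fun y hy => lt_of_lt_of_le hy (hdD x y)
      have hIon : IntegrableOn (K x) {y | ε < D x y} μ := by
        refine Integrable.of_bound hK.of_uncurry_left.aestronglyMeasurable
          (C * (ε / 9) ^ (-s)) ?_
        exact (ae_restrict_iff' (hDset' ε x)).2 (hKae ε hε x)
      rw [norm_sub_rev, ← setIntegral_sdiff (hdset ε x) hIon hsub]
      refine (norm_setIntegral_le_of_norm_le_const_ae' (C := C * (ε / 9) ^ (-s))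
        (measure_lt_top _ _) ?_).trans ?_
      · filter_upwards [hKae ε hε x] with y hy h
        exact hy h.1
      · have hball : μ.real ({y | ε < D x y} \ {y | ε < dist x y}) ≤ cμ * ε ^ s := by
          refine ENNReal.toReal_le_of_le_ofReal (by positivity)
            ((measure_mono fun y hy => ?_).trans (hgrowth x ε hε))
          rw [mem_closedBall']
          exact not_lt.1 hy.2
        refine (mul_le_mul_of_nonneg_left hball (by positivity)).trans (le_of_eq ?_)
        rw [Real.rpow_neg (by positivity), Real.div_rpow hε.le (by norm_num)]
        have := (Real.rpow_pos_of_pos hε s).ne'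
        field_simp
    · refine Eventually.of_forall fun x => ?_
      refine tendsto_const_nhds.congr' ?_
      rcases (hψ0 x).eq_or_lt with h0 | hpos
      · have hD : ∀ y, D x y = dist x y := fun y =>
          le_antisymm (by linarith [hDψ x y]) (hdD x y)
        simp [hD]
      · filter_upwards [Ioo_mem_nhdsGT (show 0 < ψ x / 4 by positivity)] with ε hε
        rw [eq_comm, sub_eq_zero]
        refine setIntegral_congr_set ?_
        filter_upwards [hψ x] with y hy
        have h1 : ε < dist x y := by linarith [hε.2]
        exact propext ⟨fun _ => h1.trans_le (hdD x y), fun _ => h1⟩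
  rw [integral_zero] at herr
  refine herr.congr' ?_
  filter_upwards [self_mem_nhdsWithin] with ε hε
  rw [integral_sub (hTint ε hε) (hDint ε hε), hDzero ε hε, sub_zero]

/-- A polynomial bound on the measure of the sublevel sets `{u ≤ τ}` gives a bound on the integrals
of small negative powers of `u`, uniform in `u`. -/
lemma exists_lintegral_rpow_neg_le {X : Type*} [MeasurableSpace X] (μ : Measure X)
    [IsFiniteMeasure μ] {p a C : ℝ} (ha : 0 < a) (hap : a < p) :
    ∃ M : ENNReal, M ≠ ⊤ ∧ ∀ u : X → ℝ, Measurable u → (∀ y, 0 ≤ u y) →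
      (∀ τ, 0 < τ → μ {y | u y ≤ τ} ≤ ENNReal.ofReal (C * τ ^ p)) →
      ∫⁻ y, ENNReal.ofReal (u y ^ (-a)) ∂μ ≤ M := by
  let A : ℕ → ℝ := fun n => ((1 / 2 : ℝ) ^ (n + 1)) ^ (-a)
  let T : ℕ → ℝ := fun n => A n * (C * ((1 / 2 : ℝ) ^ n) ^ p)
  have hA : ∀ n, 0 ≤ A n := fun n => by positivity
  have hT : Summable T := by
    have hlt : (1 / 2 : ℝ) ^ (p - a) < 1 :=
      Real.rpow_lt_one (by norm_num) (by norm_num) (sub_pos.2 hap)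
    have hgeo := (summable_geometric_of_lt_one (by positivity) hlt).mul_left
      (C * (1 / 2 : ℝ) ^ (-a))
    refine hgeo.congr fun n => ?_
    simp only [T, A]
    rw [← Real.rpow_pow_comm (by norm_num), ← Real.rpow_pow_comm (by norm_num), sub_eq_add_neg,
      Real.rpow_add (by norm_num), mul_pow, pow_succ]
    ring
  refine ⟨μ univ + ∑' n, ENNReal.ofReal (T n),
    ENNReal.add_ne_top.2 ⟨measure_ne_top _ _, hT.tsum_ofReal_ne_top⟩, fun u hu hu0 hμ => ?_⟩
  have hset : ∀ n : ℕ, MeasurableSet {y | u y ≤ (1 / 2 : ℝ) ^ n} := fun n =>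
    measurableSet_le hu measurable_const
  have hpt : ∀ y, ENNReal.ofReal (u y ^ (-a)) ≤
      1 + ∑' n, {y | u y ≤ (1 / 2 : ℝ) ^ n}.indicator (fun _ => ENNReal.ofReal (A n)) y := by
    intro y
    rcases (hu0 y).eq_or_lt with h0 | hpos
    · rw [← h0, Real.zero_rpow (neg_ne_zero.2 ha.ne')]
      simp
    rcases le_or_gt (u y) 1 with h1 | h1
    · obtain ⟨n, hn1, hn2⟩ := exists_nat_pow_near_of_lt_one hpos h1
        (show (0 : ℝ) < 1 / 2 by norm_num) (by norm_num)
      refine le_trans ?_ (le_add_self.trans' (ENNReal.le_tsum n))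
      rw [indicator_of_mem (show y ∈ {y | u y ≤ (1 / 2 : ℝ) ^ n} from hn2)]
      exact ENNReal.ofReal_le_ofReal
        (Real.rpow_le_rpow_of_nonpos (by positivity) hn1.le (neg_nonpos.2 ha.le))
    · refine le_self_add.trans' ?_
      rw [← ENNReal.ofReal_one]
      exact ENNReal.ofReal_le_ofReal
        (Real.rpow_le_one_of_one_le_of_nonpos h1.le (neg_nonpos.2 ha.le))
  refine (lintegral_mono hpt).trans ?_
  rw [lintegral_add_left measurable_const, lintegral_const, one_mul,
    lintegral_tsum fun n => (measurable_const.indicator (hset n)).aemeasurable]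
  gcongr with n
  rw [lintegral_indicator_const (hset n)]
  simp only [T]
  rw [ENNReal.ofReal_mul (hA n)]
  gcongr
  exact hμ _ (by positivity)

lemma ae_pos_of_measure_le_rpow {X : Type*} [MeasurableSpace X] (μ : Measure X)
    {p C : ℝ} (hp : 0 < p) {u : X → ℝ}
    (hμ : ∀ τ, 0 < τ → μ {y | u y ≤ τ} ≤ ENNReal.ofReal (C * τ ^ p)) :
    ∀ᵐ y ∂μ, 0 < u y := by
  have h0 : μ {y | u y ≤ 0} ≤ 0 := by
    have hlim : Tendsto (fun τ : ℝ => ENNReal.ofReal (C * τ ^ p)) (𝓝[>] 0) (𝓝 0) := by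
      have hc : Continuous fun τ : ℝ => ENNReal.ofReal (C * τ ^ p) :=
        ENNReal.continuous_ofReal.comp
          (continuous_const.mul (Real.continuous_rpow_const hp.le))
      have := (hc.tendsto 0).mono_left (nhdsWithin_le_nhds (s := Ioi 0))
      simpa [Real.zero_rpow hp.ne'] using this
    refine ge_of_tendsto hlim ?_
    filter_upwards [self_mem_nhdsWithin] with τ hτ
    exact (measure_mono fun y (hy : u y ≤ 0) => hy.trans (le_of_lt hτ)).trans (hμ τ hτ)
  rw [ae_iff]
  simpa only [not_lt] using nonpos_iff_eq_zero.1 h0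

/-- Truncated double integrals converge if, for almost every `x`, the kernel vanishes for
`dist x y < τ` with `τ^{-η}` controlled by an integrable function of `x`. -/
lemma tendsto_truncated_integral_of_vanishing {X : Type*} [MetricSpace X]
    [MeasurableSpace X] [BorelSpace X] (μ : Measure X) [IsFiniteMeasure μ] {K : X → X → ℝ}
    (hK : Measurable (Function.uncurry K)) {s η C cμ : ℝ} (hη : 0 < η) (hηs : η < s) (hC : 0 ≤ C)
    (hgrowth : ∀ (x : X) (t : ℝ), 0 < t → μ (closedBall x t) ≤ ENNReal.ofReal (cμ * t ^ s))
    (hKb : ∀ x y, |K x y| ≤ C * dist x y ^ (-s)) {B : X → ℝ} (hB : Integrable B μ)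
    (hvan : ∀ᵐ x ∂μ, ∃ τ > 0, (∀ y, dist x y < τ → K x y = 0) ∧ τ ^ (-η) ≤ B x) :
    Tendsto (fun ε : ℝ => ∫ x, ∫ y in {y | ε < dist x y}, K x y ∂μ ∂μ) (𝓝[>] 0)
      (𝓝 (∫ x, ∫ y, K x y ∂μ ∂μ)) := by
  obtain ⟨M, hMtop, hM⟩ := exists_lintegral_rpow_neg_le (X := X) μ (p := s) (a := s - η) (C := cμ)
    (by linarith) (by linarith)
  refine tendsto_integral_filter_of_dominated_convergence (fun x => C * M.toReal * B x) ?_ ?_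
    (hB.const_mul _) ?_
  · exact Eventually.of_forall fun ε =>
      (stronglyMeasurable_truncated_integral μ hK ε).aestronglyMeasurable
  · refine Eventually.of_forall fun ε => ?_
    filter_upwards [hvan] with x ⟨τ, hτ, hzero, hτB⟩
    have hpt : ∀ y, ‖K x y‖ₑ ≤
        ENNReal.ofReal (C * τ ^ (-η)) * ENNReal.ofReal (dist x y ^ (-(s - η))) := by
      intro y
      rw [← ENNReal.ofReal_mul (by positivity), ← ofReal_norm]
      refine ENNReal.ofReal_le_ofReal ?_
      rcases lt_or_ge (dist x y) τ with h | h
      · rw [hzero y h, norm_zero]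
        positivity
      · have hd : 0 < dist x y := hτ.trans_le h
        calc |K x y| ≤ C * dist x y ^ (-s) := hKb x y
          _ = C * dist x y ^ (-η) * dist x y ^ (-(s - η)) := by
            rw [mul_assoc, ← Real.rpow_add hd]
            congr 2
            ring
          _ ≤ C * τ ^ (-η) * dist x y ^ (-(s - η)) := by
            gcongr ?_ * _
            exact mul_le_mul_of_nonneg_left (rpow_neg_le_rpow_neg_of_le hτ h hη.le) hC
    have hTint : ‖∫ y in {y | ε < dist x y}, K x y ∂μ‖ₑ ≤ ENNReal.ofReal (C * τ ^ (-η)) * M :=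
      calc ‖∫ y in {y | ε < dist x y}, K x y ∂μ‖ₑ
          ≤ ∫⁻ y in {y | ε < dist x y}, ‖K x y‖ₑ ∂μ := enorm_integral_le_lintegral_enorm _
        _ ≤ ∫⁻ y, ‖K x y‖ₑ ∂μ := setLIntegral_le_lintegral _ _
        _ ≤ ∫⁻ y, ENNReal.ofReal (C * τ ^ (-η)) * ENNReal.ofReal (dist x y ^ (-(s - η))) ∂μ :=
            lintegral_mono hpt
        _ = ENNReal.ofReal (C * τ ^ (-η)) * ∫⁻ y, ENNReal.ofReal (dist x y ^ (-(s - η))) ∂μ :=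
            lintegral_const_mul' _ _ ENNReal.ofReal_ne_top
        _ ≤ ENNReal.ofReal (C * τ ^ (-η)) * M := by
            gcongr
            refine hM (dist x) (continuous_const.dist continuous_id).measurable
              (fun y => dist_nonneg) fun t ht => ?_
            refine (measure_mono fun y hy => ?_).trans (hgrowth x t ht)
            exact mem_closedBall'.2 hy
    have hreal := ENNReal.toReal_mono (ENNReal.mul_ne_top ENNReal.ofReal_ne_top hMtop) hTint
    rw [ENNReal.toReal_mul, ENNReal.toReal_ofReal (by positivity), toReal_enorm] at hreal
    refine hreal.trans ?_
    calc C * τ ^ (-η) * M.toReal = C * M.toReal * τ ^ (-η) := by ring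
      _ ≤ C * M.toReal * B x :=
        mul_le_mul_of_nonneg_left hτB (mul_nonneg hC ENNReal.toReal_nonneg)
  · filter_upwards [hvan] with x ⟨τ, hτ, hzero, _⟩
    refine tendsto_const_nhds.congr' ?_
    filter_upwards [Ioo_mem_nhdsGT hτ] with ε hε
    refine (setIntegral_eq_integral_of_forall_compl_eq_zero fun y hy => hzero y ?_).symm
    exact (not_lt.1 hy).trans_lt hε.2

/-- Around a good radius, the measure of thin annuli decays polynomially in the width. -/
lemma exists_measure_annulus_le_of_good {X : Type*} [PseudoMetricSpace X] [MeasurableSpace X]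
    (μ : Measure X) [IsFiniteMeasure μ] (z : X) (r : ℝ)
    (hgood : ∃ l : ℤ, 2 < l ∧ ∀ nn : ℕ, 1 ≤ nn →
      μ {x : X | r - (l : ℝ) ^ (-(3 * nn : ℤ)) ≤ dist z x ∧
          dist z x ≤ r + (l : ℝ) ^ (-(3 * nn : ℤ))} ≤
        ENNReal.ofReal ((l : ℝ) ^ (-(nn : ℤ)))) :
    ∃ C : ℝ, ∀ τ, 0 < τ →
      μ {x | |dist z x - r| ≤ τ} ≤ ENNReal.ofReal (C * τ ^ (1 / 3 : ℝ)) := by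
  obtain ⟨l, hl, hμ⟩ := hgood
  have hl' : (2 : ℝ) < l := by exact_mod_cast hl
  set q : ℝ := (l : ℝ)⁻¹ with hq
  have hq0 : 0 < q := by positivity
  have hq1 : q < 1 := inv_lt_one_of_one_lt₀ (by linarith)
  have hroot : ∀ n : ℕ, ((q ^ 3) ^ n) ^ (1 / 3 : ℝ) = q ^ n := by
    intro n
    rw [← pow_mul, mul_comm, pow_mul, one_div]
    exact_mod_cast Real.pow_rpow_inv_natCast (pow_nonneg hq0.le n) (three_ne_zero)
  refine ⟨l * (1 + μ.real univ), fun τ hτ => ?_⟩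
  have htriv : ∀ t, q ^ 3 ≤ t → μ {x | |dist z x - r| ≤ τ} ≤
      ENNReal.ofReal (l * (1 + μ.real univ) * t ^ (1 / 3 : ℝ)) := by
    intro t ht
    refine (measure_mono (subset_univ _)).trans ?_
    rw [← ofReal_measureReal]
    refine ENNReal.ofReal_le_ofReal ?_
    have h1 : q ≤ t ^ (1 / 3 : ℝ) := by
      have := Real.rpow_le_rpow (by positivity) ht (show (0 : ℝ) ≤ 1 / 3 by norm_num)
      have h2 := hroot 1
      rw [pow_one, pow_one] at h2
      rwa [h2] at this
    calc μ.real univ ≤ 1 + μ.real univ := by linarith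
      _ = l * (1 + μ.real univ) * q := by rw [hq]; field_simp
      _ ≤ _ := by gcongr
  rcases le_or_gt (q ^ 3) τ with h | h
  · exact htriv τ h
  · have hq3 : q ^ 3 < 1 := pow_lt_one₀ hq0.le hq1 three_ne_zero
    obtain ⟨n, hn1, hn2⟩ := exists_nat_pow_near_of_lt_one hτ (h.le.trans hq3.le)
      (pow_pos hq0 3) hq3
    have hn : 1 ≤ n := by
      by_contra! hn
      obtain rfl : n = 0 := by omega
      rw [zero_add, pow_one] at hn1
      linarith
    have he : (l : ℝ) ^ (-(3 * n : ℤ)) = (q ^ 3) ^ n := by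
      rw [zpow_neg, ← pow_mul, hq, inv_pow]
      norm_cast
    have he' : (l : ℝ) ^ (-(n : ℤ)) = q ^ n := by
      rw [zpow_neg, hq, inv_pow, zpow_natCast]
    have h1 := hμ n hn
    rw [he, he'] at h1
    refine (measure_mono fun x hx => ?_).trans (h1.trans (ENNReal.ofReal_le_ofReal ?_))
    · have := abs_le.1 (show |dist z x - r| ≤ τ from hx)
      constructor <;> linarith
    · have h2 : q ^ (n + 1) ≤ τ ^ (1 / 3 : ℝ) := by
        rw [← hroot]
        exact Real.rpow_le_rpow (by positivity) hn1.le (by norm_num)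
      calc q ^ n = l * q ^ (n + 1) := by rw [pow_succ, hq]; field_simp
        _ ≤ l * (1 + μ.real univ) * τ ^ (1 / 3 : ℝ) := by
          refine mul_le_mul ?_ h2 (by positivity) (by positivity)
          have : (0 : ℝ) ≤ μ.real univ := measureReal_nonneg
          nlinarith

/-- For finitely many balls with good radii, almost every point `x` has positive distance `τ` to
all the spheres, with `τ^{-η}` controlled by an integrable function. -/
lemma exists_integrable_bound_of_good {X : Type*} [PseudoMetricSpace X] [MeasurableSpace X]
    [OpensMeasurableSpace X] (μ : Measure X) [IsFiniteMeasure μ] {ι : Type*} [Fintype ι]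
    (z : ι → X) (r : ι → ℝ)
    (hgood : ∀ i, ∃ l : ℤ, 2 < l ∧ ∀ nn : ℕ, 1 ≤ nn →
      μ {x : X | r i - (l : ℝ) ^ (-(3 * nn : ℤ)) ≤ dist (z i) x ∧
          dist (z i) x ≤ r i + (l : ℝ) ^ (-(3 * nn : ℤ))} ≤
        ENNReal.ofReal ((l : ℝ) ^ (-(nn : ℤ))))
    {η : ℝ} (hη : 0 < η) (hη3 : η < 1 / 3) :
    ∃ B : X → ℝ, Integrable B μ ∧ ∀ᵐ x ∂μ, ∃ τ > 0, (∀ i, τ ≤ |dist (z i) x - r i|) ∧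
      τ ^ (-η) ≤ B x := by
  have hum : ∀ i, Measurable fun x => |dist (z i) x - r i| := fun i =>
    ((continuous_const.dist continuous_id).sub continuous_const).abs.measurable
  refine ⟨fun x => 1 + ∑ i, |dist (z i) x - r i| ^ (-η), ?_, ?_⟩
  · refine (integrable_const _).add (integrable_finsetSum _ fun i _ => ?_)
    obtain ⟨C, hC⟩ := exists_measure_annulus_le_of_good μ (z i) (r i) (hgood i)
    obtain ⟨M, hMtop, hM⟩ := exists_lintegral_rpow_neg_le (X := X) μ (C := C) hη hη3
    have hle := hM (fun x => |dist (z i) x - r i|) (hum i) (fun _ => abs_nonneg _) hC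
    have hm : Measurable fun x => |dist (z i) x - r i| ^ (-η) := (hum i).pow_const _
    refine ⟨hm.aestronglyMeasurable, ?_⟩
    rw [hasFiniteIntegral_iff_ofReal (Eventually.of_forall fun x => by positivity)]
    exact hle.trans_lt hMtop.lt_top
  · have hpos : ∀ᵐ x ∂μ, ∀ i, 0 < |dist (z i) x - r i| := by
      refine ae_all_iff.2 fun i => ?_
      obtain ⟨C, hC⟩ := exists_measure_annulus_le_of_good μ (z i) (r i) (hgood i)
      exact ae_pos_of_measure_le_rpow μ (by norm_num) hC
    filter_upwards [hpos] with x hx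
    rcases isEmpty_or_nonempty ι with hι | hι
    · exact ⟨1, one_pos, fun i => hι.elim i, by simp⟩
    · obtain ⟨i, hi⟩ := Finite.exists_min fun i => |dist (z i) x - r i|
      refine ⟨_, hx i, hi, ?_⟩
      have := Finset.single_le_sum (f := fun i => |dist (z i) x - r i| ^ (-η))
        (fun j _ => by positivity) (Finset.mem_univ i)
      linarith

lemma indicator_closedBall_eq_of_dist_lt {X : Type*} [PseudoMetricSpace X] {z x y : X} {r : ℝ}
    (h : dist x y < |dist z x - r|) :
    (closedBall z r).indicator (fun _ => (1 : ℝ)) y =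
      (closedBall z r).indicator (fun _ => (1 : ℝ)) x := by
  have h1 := dist_triangle z x y
  have h2 := dist_triangle z y x
  rw [dist_comm y x] at h2
  have hiff : y ∈ closedBall z r ↔ x ∈ closedBall z r := by
    rw [mem_closedBall', mem_closedBall']
    rcases lt_abs.1 h with h | h <;> constructor <;> intro h' <;> linarith
  by_cases hx : x ∈ closedBall z r
  · rw [indicator_of_mem hx, indicator_of_mem (hiff.2 hx)]
  · rw [indicator_of_notMem hx, indicator_of_notMem (mt hiff.1 hx)]

lemma measurable_sum_indicator_closedBall {X : Type*} [PseudoMetricSpace X] [MeasurableSpace X]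
    [OpensMeasurableSpace X] {ι : Type*} [Fintype ι] (a : ι → ℝ) (z : ι → X) (r : ι → ℝ) :
    Measurable fun y => ∑ i, a i * (closedBall (z i) (r i)).indicator (fun _ => (1 : ℝ)) y :=
  Finset.measurable_sum _ fun _ _ =>
    (measurable_const.indicator isClosed_closedBall.measurableSet).const_mul _

lemma abs_sum_indicator_le {X ι : Type*} [Fintype ι] (a : ι → ℝ) (S : ι → Set X) (y : X) :
    |∑ i, a i * (S i).indicator (fun _ => (1 : ℝ)) y| ≤ ∑ i, |a i| := by
  refine (Finset.abs_sum_le_sum_abs _ _).trans (Finset.sum_le_sum fun i _ => ?_)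
  rw [abs_mul]
  refine mul_le_of_le_one_right (abs_nonneg _) ?_
  by_cases h : y ∈ S i <;> simp [h]

/-- Let `μ` be a finite Borel measure with `s`-growth on a metric space `X` and `k` an
antisymmetric `s`-dimensional kernel. Let `f = ∑ i, a i · χ_{B(z i, r i)}` and
`g = ∑ j, b j · χ_{B(w j, ρ j)}` be finite linear combinations of indicator functions of
closed balls whose radii `r i, ρ j ∈ (0,1]` are good radii for `μ` at the corresponding
centers. Then `lim_{ε → 0⁺} ∫ T^k_{μ,ε}(f)(x) g(x) dμ(x)` exists, where
`T^k_{μ,ε}(f)(x) = ∫_{{y : d(x,y) > ε}} k(x,y) f(y) dμ(y)`. -/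
theorem stmt11 {X : Type*} [MetricSpace X] [MeasurableSpace X] [BorelSpace X]
    (s : ℝ) (hs : 0 < s) (μ : Measure X) [IsFiniteMeasure μ]
    (cμ : ℝ) (hcμ : 0 < cμ)
    (hgrowth : ∀ (x : X) (ρ' : ℝ), 0 < ρ' →
      μ (Metric.closedBall x ρ') ≤ ENNReal.ofReal (cμ * ρ' ^ s))
    (k : X → X → ℝ) (hkmeas : Measurable (Function.uncurry k))
    (c : ℝ) (hc : 0 < c)
    (hk : ∀ x y : X, x ≠ y → |k x y| ≤ c * (dist x y) ^ (-s))
    (hanti : ∀ x y : X, x ≠ y → k x y = - k y x)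
    (n m : ℕ) (a : Fin n → ℝ) (b : Fin m → ℝ)
    (z : Fin n → X) (w : Fin m → X) (r : Fin n → ℝ) (ρ : Fin m → ℝ)
    (hr0 : ∀ i, 0 < r i) (hr1 : ∀ i, r i ≤ 1)
    (hρ0 : ∀ j, 0 < ρ j) (hρ1 : ∀ j, ρ j ≤ 1)
    (hgoodr : ∀ i, ∃ l : ℤ, 2 < l ∧ ∀ nn : ℕ, 1 ≤ nn →
      μ {x : X | r i - (l : ℝ) ^ (-(3 * nn : ℤ)) ≤ dist (z i) x ∧
          dist (z i) x ≤ r i + (l : ℝ) ^ (-(3 * nn : ℤ))} ≤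
        ENNReal.ofReal ((l : ℝ) ^ (-(nn : ℤ))))
    (hgoodρ : ∀ j, ∃ l : ℤ, 2 < l ∧ ∀ nn : ℕ, 1 ≤ nn →
      μ {x : X | ρ j - (l : ℝ) ^ (-(3 * nn : ℤ)) ≤ dist (w j) x ∧
          dist (w j) x ≤ ρ j + (l : ℝ) ^ (-(3 * nn : ℤ))} ≤
        ENNReal.ofReal ((l : ℝ) ^ (-(nn : ℤ))))
    (f g : X → ℝ)
    (hf : f = fun y =>
      ∑ i, a i * Set.indicator (Metric.closedBall (z i) (r i)) (fun _ => (1 : ℝ)) y)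
    (hg : g = fun y =>
      ∑ j, b j * Set.indicator (Metric.closedBall (w j) (ρ j)) (fun _ => (1 : ℝ)) y) :
    ∃ L : ℝ, Filter.Tendsto
      (fun ε : ℝ =>
        ∫ x, (∫ y in {y : X | ε < dist x y}, k x y * f y ∂μ) * g x ∂μ)
      (𝓝[>] (0 : ℝ)) (𝓝 L) := by
  have hfm : Measurable f := hf ▸ measurable_sum_indicator_closedBall a z r
  have hgm : Measurable g := hg ▸ measurable_sum_indicator_closedBall b w ρ
  set Mf := ∑ i, |a i|
  set Mg := ∑ j, |b j|
  have hfb : ∀ y, |f y| ≤ Mf := fun y => by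
    rw [hf]; exact abs_sum_indicator_le a (fun i => closedBall (z i) (r i)) y
  have hgb : ∀ y, |g y| ≤ Mg := fun y => by
    rw [hg]; exact abs_sum_indicator_le b (fun j => closedBall (w j) (ρ j)) y
  have hMf : 0 ≤ Mf := by positivity
  have hMg : 0 ≤ Mg := by positivity
  obtain ⟨η, hη, hη'⟩ := exists_between (show 0 < min s (1 / 3) by positivity)
  obtain ⟨B, hB, hBae⟩ := exists_integrable_bound_of_good μ (Sum.elim z w) (Sum.elim r ρ)
    (by rintro (i | j); exacts [hgoodr i, hgoodρ j]) hη (hη'.trans_le (min_le_right _ _))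
  let k' : X → X → ℝ := fun x y => (k x y - k y x) / 2
  have hswap : Measurable (Function.uncurry fun x y => k y x) := hkmeas.comp measurable_swap
  have hk'm : Measurable (Function.uncurry k') := (hkmeas.sub hswap).div_const 2
  have hk'k : ∀ x y, x ≠ y → k' x y = k x y := fun x y hxy => by
    simp only [k']
    linarith [hanti x y hxy]
  have hk'b : ∀ x y, |k' x y| ≤ c * dist x y ^ (-s) := by
    intro x y
    rcases eq_or_ne x y with rfl | hxy
    · simp only [k', sub_self, zero_div, abs_zero]
      positivity
    · rw [hk'k x y hxy]
      exact hk x y hxy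
  have hf1 : Measurable fun p : X × X => f p.1 := hfm.comp measurable_fst
  have hf2 : Measurable fun p : X × X => f p.2 := hfm.comp measurable_snd
  have hg1 : Measurable fun p : X × X => g p.1 := hgm.comp measurable_fst
  have hg2 : Measurable fun p : X × X => g p.2 := hgm.comp measurable_snd
  let K₁ : X → X → ℝ := fun x y => k' x y * ((f y * g x + f x * g y) / 2)
  let K₂ : X → X → ℝ := fun x y => k' x y * ((f y * g x - f x * g y) / 2)
  have hK₁m : Measurable (Function.uncurry K₁) :=
    hk'm.mul (((hf2.mul hg1).add (hf1.mul hg2)).div_const 2)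
  have hK₂m : Measurable (Function.uncurry K₂) :=
    hk'm.mul (((hf2.mul hg1).sub (hf1.mul hg2)).div_const 2)
  have hfg : ∀ x y, |f x * g y| ≤ Mf * Mg := fun x y => by
    rw [abs_mul]
    exact mul_le_mul (hfb x) (hgb y) (abs_nonneg _) hMf
  have hbound : ∀ x y t, |t| ≤ Mf * Mg →
      |k' x y * t| ≤ c * (Mf * Mg) * dist x y ^ (-s) := by
    intro x y t ht
    rw [abs_mul, mul_right_comm]
    exact mul_le_mul (hk'b x y) ht (abs_nonneg _) (by positivity)
  have hK₁b : ∀ x y, |K₁ x y| ≤ c * (Mf * Mg) * dist x y ^ (-s) := by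
    refine fun x y => hbound x y _ (abs_le.2 ?_)
    have h1 := abs_le.1 (hfg y x)
    have h2 := abs_le.1 (hfg x y)
    constructor <;> linarith
  have hK₂b : ∀ x y, |K₂ x y| ≤ c * (Mf * Mg) * dist x y ^ (-s) := by
    refine fun x y => hbound x y _ (abs_le.2 ?_)
    have h1 := abs_le.1 (hfg y x)
    have h2 := abs_le.1 (hfg x y)
    constructor <;> linarith
  have hC : 0 ≤ c * (Mf * Mg) := by positivity
  have hlim₁ := tendsto_truncated_integral_of_antisymm μ hK₁m hs hC hcμ.le hgrowth hK₁b
    (fun x y => by simp only [K₁, k']; ring)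
  have hlim₂ := tendsto_truncated_integral_of_vanishing μ hK₂m hη
    (hη'.trans_le (min_le_left _ _)) hC hgrowth hK₂b hB (by
      filter_upwards [hBae] with x ⟨τ, hτ, hτle, hτB⟩
      refine ⟨τ, hτ, fun y hy => ?_, hτB⟩
      have hfeq : f y = f x := by
        simp only [hf]
        refine Finset.sum_congr rfl fun i _ => ?_
        rw [indicator_closedBall_eq_of_dist_lt (z := z i) (r := r i)
          (hy.trans_le (hτle (Sum.inl i)))]
      have hgeq : g y = g x := by
        simp only [hg]
        refine Finset.sum_congr rfl fun j _ => ?_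
        rw [indicator_closedBall_eq_of_dist_lt (z := w j) (r := ρ j)
          (hy.trans_le (hτle (Sum.inr j)))]
      simp only [K₂, hfeq, hgeq, sub_self, zero_div, mul_zero])
  refine ⟨_, (hlim₁.add hlim₂).congr' ?_⟩
  filter_upwards [self_mem_nhdsWithin] with ε hε
  replace hε : 0 < ε := hε
  rw [← integral_add (integrable_truncated_integral μ hK₁m hs hC hK₁b hε)
    (integrable_truncated_integral μ hK₂m hs hC hK₂b hε)]
  refine integral_congr_ae (Eventually.of_forall fun x => ?_)
  simp only
  rw [← integral_add (integrableOn_lt_dist_of_abs_le μ hK₁m hs hC hK₁b hε x)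
    (integrableOn_lt_dist_of_abs_le μ hK₂m hs hC hK₂b hε x), ← integral_mul_const]
  have hmeas : MeasurableSet {y | ε < dist x y} :=
    (isOpen_lt continuous_const (continuous_const.dist continuous_id)).measurableSet
  refine setIntegral_congr_fun hmeas fun y hy => ?_
  have hxy : x ≠ y := dist_pos.1 (hε.trans hy)
  simp only [K₁, K₂, ← hk'k x y hxy]
  ring
end

section
/- Let (X,d) be a metric space, let s > 0, and let μ be a finite Borel measure on X with s-growth with constant c_μ. Let z ∈ X, 0 < r ≤ 1, B = B(z,r) the closed ball, and let x satisfy d(x,z) < r. Then ∫_{B(x,2) \ B} d(x,y)^{−s} dμ(y) ≤ C·(1 + |log dist(x, X \ B)|), where C depends only on s and c_μ. -/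
open MeasureTheory Set Filter Metric

/-- The contribution of a single dyadic annulus to the integral of `d(x,y)^{-s}`. -/
lemma lintegral_dyadic_annulus_le {X : Type*} [MetricSpace X] [MeasurableSpace X]
    {s cμ : ℝ} (hs : 0 < s) (hcμ : 0 < cμ) {μ : Measure X} {x : X}
    (hμ : ∀ ρ : ℝ, 0 < ρ → μ (closedBall x ρ) ≤ ENNReal.ofReal (cμ * ρ ^ s))
    {ρ : ℝ} (hρ : 0 < ρ) :
    ∫⁻ y in {y | ρ / 2 < dist x y ∧ dist x y ≤ ρ}, ENNReal.ofReal (dist x y ^ (-s)) ∂μ ≤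
      ENNReal.ofReal (cμ * 2 ^ s) := by
  set A : Set X := {y | ρ / 2 < dist x y ∧ dist x y ≤ ρ}
  calc ∫⁻ y in A, ENNReal.ofReal (dist x y ^ (-s)) ∂μ
      ≤ ∫⁻ _ in A, ENNReal.ofReal ((ρ / 2) ^ (-s)) ∂μ := by
        refine setLIntegral_mono measurable_const fun y hy => ENNReal.ofReal_le_ofReal ?_
        exact Real.rpow_le_rpow_of_nonpos (half_pos hρ) hy.1.le (by linarith)
    _ = ENNReal.ofReal ((ρ / 2) ^ (-s)) * μ A := setLIntegral_const _ _
    _ ≤ ENNReal.ofReal ((ρ / 2) ^ (-s)) * ENNReal.ofReal (cμ * ρ ^ s) := by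
        gcongr
        refine (measure_mono fun y hy => ?_).trans (hμ ρ hρ)
        rw [mem_closedBall, dist_comm]
        exact hy.2
    _ = ENNReal.ofReal (cμ * 2 ^ s) := by
        rw [← ENNReal.ofReal_mul (by positivity)]
        congr 1
        rw [Real.rpow_neg (by positivity), Real.div_rpow hρ.le (by norm_num)]
        have h1 : ρ ^ s ≠ 0 := (Real.rpow_pos_of_pos hρ s).ne'
        field_simp

/-- The integral of `d(x,y)^{-s}` over an annulus grows at most linearly in the number of dyadic
scales it spans. -/
lemma lintegral_annulus_le {X : Type*} [MetricSpace X] [MeasurableSpace X]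
    {s cμ : ℝ} (hs : 0 < s) (hcμ : 0 < cμ) {μ : Measure X} {x : X}
    (hμ : ∀ ρ : ℝ, 0 < ρ → μ (closedBall x ρ) ≤ ENNReal.ofReal (cμ * ρ ^ s))
    {R : ℝ} (hR : 0 < R) (n : ℕ) :
    ∫⁻ y in {y | R / 2 ^ n < dist x y ∧ dist x y ≤ R}, ENNReal.ofReal (dist x y ^ (-s)) ∂μ ≤
      ENNReal.ofReal (n * (cμ * 2 ^ s)) := by
  induction n with
  | zero =>
    have h : {y | R / 2 ^ 0 < dist x y ∧ dist x y ≤ R} = (∅ : Set X) := by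
      ext y
      simp
    rw [h]
    simp
  | succ n ih =>
    have hsub : {y | R / 2 ^ (n + 1) < dist x y ∧ dist x y ≤ R} ⊆
        {y | R / 2 ^ n < dist x y ∧ dist x y ≤ R} ∪
          {y | R / 2 ^ n / 2 < dist x y ∧ dist x y ≤ R / 2 ^ n} := by
      rintro y ⟨h1, h2⟩
      rw [pow_succ, ← div_div] at h1
      rcases lt_or_ge (R / 2 ^ n) (dist x y) with h | h
      · exact Or.inl ⟨h, h2⟩
      · exact Or.inr ⟨h1, h⟩
    refine (lintegral_mono_set hsub).trans ((lintegral_union_le _ _ _).trans ?_)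
    refine (add_le_add ih (lintegral_dyadic_annulus_le hs hcμ hμ (by positivity))).trans_eq ?_
    rw [← ENNReal.ofReal_add (by positivity) (by positivity)]
    congr 1
    push_cast
    ring

/-- Let `μ` be a finite Borel measure with `s`-growth (constant `cμ`) on a metric space
`X`. For `B = B(z,r)` a closed ball with `0 < r ≤ 1` and `x` with `d(x,z) < r`, one has
`∫_{B(x,2) \ B} d(x,y)^{-s} dμ(y) ≤ C·(1 + |log dist(x, X \ B)|)`, where `C` depends
only on `s` and `cμ`. -/
theorem stmt15 (s : ℝ) (hs : 0 < s) (cμ : ℝ) (hcμ : 0 < cμ) :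
    ∃ C : ℝ, 0 < C ∧
      ∀ (X : Type) [MetricSpace X] [MeasurableSpace X] [BorelSpace X]
        (μ : Measure X), IsFiniteMeasure μ →
        (∀ (x : X) (ρ : ℝ), 0 < ρ →
          μ (Metric.closedBall x ρ) ≤ ENNReal.ofReal (cμ * ρ ^ s)) →
        ∀ (z : X) (r : ℝ), 0 < r → r ≤ 1 → ∀ x : X, dist x z < r →
          ∫⁻ y in Metric.closedBall x 2 \ Metric.closedBall z r,
              ENNReal.ofReal ((dist x y) ^ (-s)) ∂μ ≤
            ENNReal.ofReal
              (C * (1 + |Real.log (Metric.infDist x (Metric.closedBall z r)ᶜ)|)) := by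
  refine ⟨2 * (cμ * 2 ^ s), by positivity, ?_⟩
  intro X _ _ _ μ _ hμ z r _ _ x hx
  rcases (closedBall z r)ᶜ.eq_empty_or_nonempty with he | hne
  · simp [sdiff_eq, he]
  set δ := infDist x (closedBall z r)ᶜ
  have hδ : 0 < δ := by
    refine (infDist_pos_iff_notMem_closure hne).1 ?_
    rw [closure_compl, notMem_compl_iff]
    exact ball_subset_interior_closedBall hx
  have hlog : 1 / 2 < Real.log 2 := by linarith [Real.log_two_gt_d9]
  have hlog_pos : 0 < Real.log 2 := by linarith
  set t := (Real.log 2 + |Real.log δ|) / Real.log 2 with ht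
  set n := ⌊t⌋₊ + 1 with hn
  have hn_gt : t < n := by
    rw [hn]
    exact_mod_cast Nat.lt_floor_add_one t
  have hn_le : (n : ℝ) ≤ 2 * (1 + |Real.log δ|) := by
    have h1 : (⌊t⌋₊ : ℝ) ≤ t := Nat.floor_le (by positivity)
    have h2 : t ≤ 1 + 2 * |Real.log δ| := by
      rw [ht, div_le_iff₀ hlog_pos]
      nlinarith [abs_nonneg (Real.log δ)]
    rw [hn]
    push_cast
    linarith
  have hscale : 2 / 2 ^ n < δ := by
    rw [← Real.log_lt_log_iff (by positivity) hδ, Real.log_div (by norm_num) (by positivity),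
      Real.log_pow]
    rw [ht, div_lt_iff₀ hlog_pos] at hn_gt
    linarith [neg_abs_le (Real.log δ)]
  have hsub : closedBall x 2 \ closedBall z r ⊆ {y | 2 / 2 ^ n < dist x y ∧ dist x y ≤ 2} := by
    rintro y ⟨hy, hyB⟩
    exact ⟨hscale.trans_le (infDist_le_dist_of_mem hyB), by rwa [mem_closedBall, dist_comm] at hy⟩
  refine (lintegral_mono_set hsub).trans
    ((lintegral_annulus_le hs hcμ (hμ x) two_pos n).trans (ENNReal.ofReal_le_ofReal ?_))
  have hC : 0 < cμ * 2 ^ s := by positivity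
  nlinarith
end
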